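/- arXiv:1909.03381 — 2 statements merged into one kernel-verified Lean document; each statement's English description precedes it below -/
import Mathlib

section
/- Let T be a tree on n >= 4 vertices with matching number m, where 1 <= m <= floor(n/2). Then s(T) <= m(n - m), with equality if and only if T is isomorphic to the dumbbell D_n(ceil((n+1)/2) - m, floor((n+1)/2) - m). -/
open SimpleGraph

variable {V : Type*}

/-- The status of a vertex: sum of distances to all other vertices. -/
noncomputable def status [Fintype V] (G : SimpleGraph V) (u : V) : ℕ :=
  ∑ v : V, G.dist u v

/-- The minimum status of a graph. -/
noncomputable def minStatus [Fintype V] (G : SimpleGraph V) : ℕ :=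
  sInf (Set.range (status G))

/-- The matching number: maximum cardinality of a matching. -/
noncomputable def matchingNumber (G : SimpleGraph V) : ℕ :=
  sSup {k | ∃ M : G.Subgraph, M.IsMatching ∧ M.edgeSet.ncard = k}

/-- The domination number: minimum cardinality of a dominating set. -/
noncomputable def domNumber (G : SimpleGraph V) : ℕ :=
  sInf {k | ∃ S : Set V, (∀ v ∉ S, ∃ u ∈ S, G.Adj u v) ∧ S.ncard = k}

/-- The dumbbell `D_n(p,q)`: a path on `n - p - q` vertices `0, …, n-p-q-1`,
with `p` pendant vertices attached to vertex `0` and `q` pendant vertices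
attached to vertex `n-p-q-1`. -/
def dumbbell (n p q : ℕ) : SimpleGraph (Fin n) :=
  SimpleGraph.fromRel (fun a b =>
    ((a : ℕ) + 1 = (b : ℕ) ∧ (b : ℕ) < n - p - q) ∨
    ((a : ℕ) = 0 ∧ n - p - q ≤ (b : ℕ) ∧ (b : ℕ) < n - q) ∨
    ((a : ℕ) = n - p - q - 1 ∧ n - q ≤ (b : ℕ)))

/-- The tree `A_{n,m}`: a star with center `0` and leaves `1, …, n-m`, with one
pendant vertex `n-m+i` attached to leaf `i` for each `i = 1, …, m-1`. -/
def treeA (n m : ℕ) : SimpleGraph (Fin n) :=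
  SimpleGraph.fromRel (fun a b =>
    ((a : ℕ) = 0 ∧ 1 ≤ (b : ℕ) ∧ (b : ℕ) ≤ n - m) ∨
    (1 ≤ (a : ℕ) ∧ (a : ℕ) ≤ m - 1 ∧ (b : ℕ) = n - m + (a : ℕ)))

/-- The caterpillar `C_n(p,q)`: a path on vertices `0, …, n-p-q-1`; pendant
vertex `n-p-q+j` is attached to path vertex `j` for `j = 0, …, p-1`, and pendant
vertex `n-q+j` is attached to path vertex `n-p-2q+j` for `j = 0, …, q-1`. -/
def caterpillar (n p q : ℕ) : SimpleGraph (Fin n) :=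
  SimpleGraph.fromRel (fun a b =>
    ((a : ℕ) + 1 = (b : ℕ) ∧ (b : ℕ) < n - p - q) ∨
    (n - p - q ≤ (b : ℕ) ∧ (b : ℕ) < n - q ∧ (a : ℕ) = (b : ℕ) - (n - p - q)) ∨
    (n - q ≤ (b : ℕ) ∧ (a : ℕ) = (b : ℕ) - p - q))

lemma minStatus_le_status [Fintype V] (G : SimpleGraph V) (u : V) :
    minStatus G ≤ status G u :=
  Nat.sInf_le ⟨u, rfl⟩

lemma le_minStatus [Fintype V] [Nonempty V] {G : SimpleGraph V} {k : ℕ}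
    (h : ∀ u, k ≤ status G u) : k ≤ minStatus G := by
  obtain ⟨u, hu⟩ := Nat.sInf_mem (Set.range_nonempty (status G))
  exact (h u).trans_eq hu

lemma SimpleGraph.Connected.dist_iso_le {W : Type*} {G : SimpleGraph V} {H : SimpleGraph W}
    (hG : G.Connected) (e : G ≃g H) (u v : V) : H.dist (e u) (e v) ≤ G.dist u v := by
  obtain ⟨w, hw⟩ := hG.exists_walk_length_eq_dist u v
  rw [← hw, ← w.length_map e.toHom]
  exact dist_le _

lemma minStatus_eq_of_iso {W : Type*} [Fintype V] [Fintype W] {G : SimpleGraph V}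
    {H : SimpleGraph W} (hG : G.Connected) (e : G ≃g H) : minStatus G = minStatus H := by
  have hH : H.Connected := e.connected_iff.mp hG
  have hstatus (u : V) : status H (e u) = status G u := by
    refine (e.toEquiv.sum_comp (fun w => H.dist (e u) w)).symm.trans
      (Finset.sum_congr rfl fun v _ => (hG.dist_iso_le e u v).antisymm ?_)
    simpa using hH.dist_iso_le e.symm (e u) (e v)
  have hrange : Set.range (status G) = Set.range (status H) := by
    rw [← e.surjective.range_comp]
    exact congrArg _ (funext fun u => (hstatus u).symm)
  rw [minStatus, minStatus, hrange]

/-- Consecutive adjacent vertices span walks between any two members of the sequence. -/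
lemma exists_walk_of_adj_succ {G : SimpleGraph V} {P : ℕ → V} {D i j : ℕ}
    (hP : ∀ i < D, G.Adj (P i) (P (i + 1))) (hij : i ≤ j) (hj : j ≤ D) :
    ∃ w : G.Walk (P i) (P j), w.length = j - i := by
  induction j, hij using Nat.le_induction with
  | base => exact ⟨Walk.nil, by simp⟩
  | succ j hij ih =>
    obtain ⟨w, hw⟩ := ih (by omega)
    exact ⟨w.concat (hP j (by omega)), by rw [Walk.length_concat]; omega⟩

lemma SimpleGraph.Connected.exists_geodesic {G : SimpleGraph V} (hG : G.Connected) (u v : V) :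
    ∃ P : ℕ → V, P 0 = u ∧ P (G.dist u v) = v ∧
      (∀ i < G.dist u v, G.Adj (P i) (P (i + 1))) ∧
      ∀ i j, i ≤ j → j ≤ G.dist u v → G.dist (P i) (P j) = j - i := by
  obtain ⟨w, hw⟩ := hG.exists_walk_length_eq_dist u v
  have hadj : ∀ i < G.dist u v, G.Adj (w.getVert i) (w.getVert (i + 1)) :=
    fun i hi => w.adj_getVert_succ (by omega)
  have hle {i j : ℕ} (hij : i ≤ j) (hj : j ≤ G.dist u v) :
      G.dist (w.getVert i) (w.getVert j) ≤ j - i := by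
    obtain ⟨q, hq⟩ := exists_walk_of_adj_succ hadj hij hj
    exact hq ▸ dist_le q
  have hend : w.getVert (G.dist u v) = v := by rw [← hw, w.getVert_length]
  refine ⟨w.getVert, w.getVert_zero, hend, hadj, fun i j hij hj => (hle hij hj).antisymm ?_⟩
  have h0 := hle (Nat.zero_le i) (hij.trans hj)
  have h1 := hle hj le_rfl
  rw [w.getVert_zero] at h0
  rw [hend] at h1
  have h2 := hG.dist_triangle (u := u) (v := w.getVert i) (w := v)
  have h3 := hG.dist_triangle (u := w.getVert i) (v := w.getVert j) (w := v)
  omega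

/-- A vertex of the geodesic between `u` and `v` in a tree lies on a geodesic from any vertex `x`
to one of `u` and `v`. -/
lemma SimpleGraph.IsTree.dist_eq_add_or {T : SimpleGraph V} (hT : T.IsTree) {u v c : V}
    (hc : T.dist u v = T.dist u c + T.dist c v) (x : V) :
    T.dist u x = T.dist u c + T.dist c x ∨ T.dist x v = T.dist x c + T.dist c v := by
  classical
  have hsplit {a b : V} (w : T.Walk a b) (hw : w.length = T.dist a b) (h : c ∈ w.support) :
      T.dist a b = T.dist a c + T.dist c b := by
    refine (hT.connected.dist_triangle).antisymm ?_
    have h1 := dist_le (w.takeUntil c h)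
    have h2 := dist_le (w.dropUntil c h)
    have h3 := congrArg Walk.length (w.take_spec h)
    rw [Walk.length_append] at h3
    omega
  obtain ⟨p, hp⟩ := hT.connected.exists_walk_length_eq_dist u c
  obtain ⟨q, hq⟩ := hT.connected.exists_walk_length_eq_dist c v
  obtain ⟨r, hr⟩ := hT.connected.exists_walk_length_eq_dist u x
  obtain ⟨s, hs⟩ := hT.connected.exists_walk_length_eq_dist x v
  have hpq : (p.append q).IsPath :=
    Walk.isPath_of_length_eq_dist _ (by rw [Walk.length_append, hp, hq, hc])
  have heq : (r.append s).bypass = p.append q :=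
    (hT.existsUnique_path u v).unique (Walk.bypass_isPath _) hpq
  have hmem : c ∈ (r.append s).support := by
    apply Walk.support_bypass_subset_support
    rw [heq, Walk.mem_support_append_iff]
    exact Or.inl p.end_mem_support
  rcases (Walk.mem_support_append_iff _ _).mp hmem with h | h
  · exact Or.inl (hsplit r hr h)
  · exact Or.inr (hsplit s hs h)

/-- A path with at least `2 * r` vertices contains a matching with `r` edges. -/
lemma le_matchingNumber [Finite V] {G : SimpleGraph V} {P : ℕ → V} {r : ℕ}
    (hadj : ∀ i < r, G.Adj (P (2 * i)) (P (2 * i + 1)))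
    (hinj : ∀ i < 2 * r, ∀ j < 2 * r, P i = P j → i = j) : r ≤ matchingNumber G := by
  classical
  let f : Fin r → G.Subgraph := fun i => G.subgraphOfAdj (hadj i i.2)
  have hM : (⨆ i, f i).IsMatching := by
    refine Subgraph.IsMatching.iSup (fun i => Subgraph.IsMatching.subgraphOfAdj _) ?_
    intro i j hij
    have hij' : (i : ℕ) ≠ j := fun h => hij (Fin.ext h)
    rw [Set.disjoint_left]
    simp only [f, support_subgraphOfAdj, Set.mem_insert_iff, Set.mem_singleton_iff]
    rintro x (rfl | rfl) (h | h) <;>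
    · have := hinj _ (by omega) _ (by omega) h
      omega
  have hinjEdge : Function.Injective fun i : Fin r => s(P (2 * i), P (2 * i + 1)) := by
    intro i j hij
    rcases Sym2.eq_iff.mp hij with ⟨h, -⟩ | ⟨h, -⟩
    · have := hinj _ (by omega) _ (by omega) h
      exact Fin.ext (by omega)
    · have := hinj _ (by omega) _ (by omega) h
      omega
  have hcard : (⨆ i, f i).edgeSet.ncard = r := by
    have : (⨆ i, f i).edgeSet = Set.range fun i : Fin r => s(P (2 * i), P (2 * i + 1)) := by
      simp only [f, Subgraph.edgeSet_iSup, edgeSet_subgraphOfAdj, Set.iUnion_singleton_eq_range]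
    rw [this, ← Set.image_univ, Set.ncard_image_of_injective _ hinjEdge, Set.ncard_univ,
      Nat.card_fin]
  refine le_csSup ⟨Nat.card (Sym2 V), ?_⟩ ⟨_, hM, hcard⟩
  rintro k ⟨M, -, rfl⟩
  exact Set.ncard_le_card _

lemma eq_of_geodesic_eq {G : SimpleGraph V} {D i j : ℕ} {P : ℕ → V}
    (hdist : ∀ i j, i ≤ j → j ≤ D → G.dist (P i) (P j) = j - i) (hi : i ≤ D) (hj : j ≤ D)
    (hij : P i = P j) : i = j := by
  rcases le_total i j with h | h
  · have := hdist i j h hj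
    rw [hij, dist_self] at this
    omega
  · have := hdist j i h hi
    rw [hij, dist_self] at this
    omega

/-- A tree has a diametral geodesic, and every vertex is within half the diameter of its middle. -/
lemma SimpleGraph.IsTree.exists_diametral_geodesic [Finite V] {T : SimpleGraph V}
    (hT : T.IsTree) :
    ∃ (D : ℕ) (P : ℕ → V), (∀ i < D, T.Adj (P i) (P (i + 1))) ∧
      (∀ i j, i ≤ j → j ≤ D → T.dist (P i) (P j) = j - i) ∧
      ∀ x, T.dist (P ((D + 1) / 2)) x ≤ (D + 1) / 2 := by
  have := hT.connected.nonempty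
  obtain ⟨u, v, huv⟩ := T.exists_dist_eq_diam
  have hdiam (a b : V) : T.dist a b ≤ T.dist u v :=
    huv ▸ dist_le_diam (connected_iff_ediam_ne_top.mp hT.connected)
  obtain ⟨P, h0, hD, hadj, hdist⟩ := hT.connected.exists_geodesic u v
  refine ⟨T.dist u v, P, hadj, hdist, fun x => ?_⟩
  have h1 := hdist 0 ((T.dist u v + 1) / 2) (by omega) (by omega)
  have h2 := hdist ((T.dist u v + 1) / 2) (T.dist u v) (by omega) le_rfl
  rw [h0] at h1
  rw [hD] at h2
  have hux := hdiam u x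
  have hxv := hdiam x v
  have hcomm := T.dist_comm (u := x) (v := P ((T.dist u v + 1) / 2))
  rcases hT.dist_eq_add_or (u := u) (v := v) (c := P ((T.dist u v + 1) / 2)) (by omega) x with h | h <;> omega

lemma two_mul_sum_range_natDist (R e : ℕ) :
    2 * ∑ i ∈ Finset.range (R + e + 1), ((R - i) + (i - R)) = R * (R + 1) + e * (e + 1) := by
  induction e with
  | zero =>
    induction R with
    | zero => simp
    | succ R ih =>
      rw [Finset.sum_range_succ']
      simp only [Nat.add_sub_add_right] at ih ⊢
      rw [mul_add]
      have : R + 1 + 0 = R + 0 + 1 := by ring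
      rw [this, ih]
      simp
      ring
  | succ e ih =>
    rw [← add_assoc, Finset.sum_range_succ, mul_add, ih,
      show R - (R + e + 1) + (R + e + 1 - R) = e + 1 by omega]
    ring

/-- The vertex in the middle of a geodesic that realizes its eccentricity has status at most
`R * (n - R)`; in case of equality all vertices off the geodesic are at distance `R`. -/
lemma status_le_of_geodesic [Fintype V] {G : SimpleGraph V} {D R : ℕ} {P : ℕ → V}
    (hR : R = (D + 1) / 2)
    (hdist : ∀ i j, i ≤ j → j ≤ D → G.dist (P i) (P j) = j - i)
    (hecc : ∀ x, G.dist (P R) x ≤ R) :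
    status G (P R) ≤ R * (Fintype.card V - R) ∧
      (status G (P R) = R * (Fintype.card V - R) →
        ∀ x, (∀ i ≤ D, P i ≠ x) → G.dist (P R) x = R) := by
  classical
  have hinj : Set.InjOn P (Finset.range (D + 1)) := by
    intro i hi j hj hij
    simp only [Finset.coe_range, Set.mem_Iio] at hi hj
    exact eq_of_geodesic_eq hdist (by omega) (by omega) hij
  set S := (Finset.range (D + 1)).image P with hS
  have hcardS : S.card = D + 1 := by
    rw [hS, Finset.card_image_of_injOn hinj, Finset.card_range]
  have hcard : Fintype.card V = D + 1 + Sᶜ.card := by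
    rw [← hcardS, Finset.card_add_card_compl]
  have hsum : status G (P R) = ∑ i ∈ Finset.range (D + 1), ((R - i) + (i - R)) +
      ∑ x ∈ Sᶜ, G.dist (P R) x := by
    rw [status, ← Finset.sum_add_sum_compl S, hS, Finset.sum_image hinj]
    congr 1
    refine Finset.sum_congr rfl fun i hi => ?_
    rw [Finset.mem_range] at hi
    rcases le_total R i with h | h
    · rw [hdist R i h (by omega)]
      omega
    · rw [G.dist_comm, hdist i R h (by omega)]
      omega
  have htotal : ∑ i ∈ Finset.range (D + 1), ((R - i) + (i - R)) + Sᶜ.card * R =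
      R * (Fintype.card V - R) := by
    obtain ⟨e, he⟩ : ∃ e, D = R + e := ⟨D - R, by omega⟩
    have hsumR := two_mul_sum_range_natDist R e
    rw [← he] at hsumR
    rw [show Fintype.card V - R = e + 1 + Sᶜ.card by omega]
    obtain rfl | rfl : R = e ∨ R = e + 1 := by omega
    · nlinarith
    · nlinarith
  have hle : ∑ x ∈ Sᶜ, G.dist (P R) x ≤ Sᶜ.card * R :=
    Finset.sum_le_card_nsmul _ _ _ fun x _ => hecc x
  refine ⟨by omega, fun heq x hx => ?_⟩
  have heq' : ∑ x ∈ Sᶜ, G.dist (P R) x = ∑ _x ∈ Sᶜ, R := by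
    rw [Finset.sum_const, smul_eq_mul]
    omega
  refine (Finset.sum_eq_sum_iff_of_le fun x _ => hecc x).mp heq' x ?_
  simp only [hS, Finset.mem_compl, Finset.mem_image, Finset.mem_range, not_exists, not_and]
  exact fun i hi => hx i (by omega)

/-- The coordinate of the `i`-th vertex of a dumbbell with a handle of `2 * k + 1` vertices along
the line through the handle: the handle occupies `1, …, 2 * k + 1`, and the two bunches of pendant
vertices occupy `0` and `2 * k + 2`. -/
def dumbbellPos (k a i : ℕ) : ℤ :=
  if i < 2 * k + 1 then i + 1 else if i < 2 * k + 1 + a then 0 else 2 * k + 2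

lemma sum_dumbbellPos (k a b : ℕ) (F : ℤ → ℤ) :
    ∑ i : Fin (2 * k + 1 + a + b), F (dumbbellPos k a i) =
      ∑ j ∈ Finset.range (2 * k + 1), F (j + 1) + a * F 0 + b * F (2 * k + 2) := by
  rw [Fin.sum_univ_eq_sum_range (fun i => F (dumbbellPos k a i)), Finset.sum_range_add,
    Finset.sum_range_add]
  congr 1
  · congr 1
    · refine Finset.sum_congr rfl fun i hi => ?_
      rw [Finset.mem_range] at hi
      rw [dumbbellPos, if_pos hi]
    · rw [Finset.sum_congr rfl (g := fun _ => F 0), Finset.sum_const, Finset.card_range,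
        nsmul_eq_mul]
      intro i hi
      rw [Finset.mem_range] at hi
      rw [dumbbellPos, if_neg (by omega), if_pos (by omega)]
  · rw [Finset.sum_congr rfl (g := fun _ => F (2 * k + 2)), Finset.sum_const, Finset.card_range,
      nsmul_eq_mul]
    intro i hi
    rw [dumbbellPos, if_neg (by omega), if_neg (by omega)]

lemma le_sum_range_abs_sub (k : ℕ) (x : ℤ) :
    k * (k + 1) + |k - x| ≤ ∑ j ∈ Finset.range (2 * k + 1), |(j : ℤ) - x| := by
  induction k generalizing x with
  | zero => simp
  | succ k ih =>
    rw [show 2 * (k + 1) + 1 = 2 * k + 1 + 1 + 1 by ring, Finset.sum_range_succ,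
      Finset.sum_range_succ']
    have h := ih (x - 1)
    have hshift (y : ℤ) : y - (x - 1) = y + 1 - x := by ring
    simp only [hshift] at h
    have h0 : (2 * k + 2 : ℤ) ≤ |0 - x| + |2 * k + 2 - x| := by
      rcases abs_cases (0 - x) with h | h <;> rcases abs_cases (2 * k + 2 - x) with h' | h' <;>
        omega
    push_cast
    linarith

lemma sum_range_abs_sub_eq (k : ℕ) (x : ℤ) (hx : |k - x| ≤ 1) :
    ∑ j ∈ Finset.range (2 * k + 1), |(j : ℤ) - x| = k * (k + 1) + |k - x| := by
  induction k generalizing x with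
  | zero => simp
  | succ k ih =>
    rw [show 2 * (k + 1) + 1 = 2 * k + 1 + 1 + 1 by ring, Finset.sum_range_succ,
      Finset.sum_range_succ']
    have hshift (y : ℤ) : y - (x - 1) = y + 1 - x := by ring
    push_cast at hx
    have h := ih (x - 1) (by rwa [hshift])
    simp only [hshift] at h
    rw [abs_le] at hx
    have h0 : |0 - x| + |2 * k + 2 - x| = 2 * k + 2 := by
      rw [abs_of_nonpos (by omega), abs_of_nonneg (by omega)]
      ring
    push_cast
    linarith

lemma dumbbell_adj_iff (k a b : ℕ) (i j : Fin (2 * k + 1 + a + b)) :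
    (dumbbell (2 * k + 1 + a + b) a b).Adj i j ↔ i ≠ j ∧
      ((((i : ℕ) + 1 = j ∧ (j : ℕ) < 2 * k + 1) ∨
        ((i : ℕ) = 0 ∧ 2 * k + 1 ≤ (j : ℕ) ∧ (j : ℕ) < 2 * k + 1 + a) ∨
        ((i : ℕ) = 2 * k ∧ 2 * k + 1 + a ≤ (j : ℕ))) ∨
      (((j : ℕ) + 1 = i ∧ (i : ℕ) < 2 * k + 1) ∨
        ((j : ℕ) = 0 ∧ 2 * k + 1 ≤ (i : ℕ) ∧ (i : ℕ) < 2 * k + 1 + a) ∨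
        ((j : ℕ) = 2 * k ∧ 2 * k + 1 + a ≤ (i : ℕ)))) := by
  rw [dumbbell, SimpleGraph.fromRel_adj]
  simp only [show 2 * k + 1 + a + b - a - b = 2 * k + 1 by omega,
    show 2 * k + 1 + a + b - b = 2 * k + 1 + a by omega, Nat.add_sub_cancel]

lemma abs_dumbbellPos_sub_le_one {k a b : ℕ} {i j : Fin (2 * k + 1 + a + b)}
    (h : (dumbbell (2 * k + 1 + a + b) a b).Adj i j) :
    |dumbbellPos k a i - dumbbellPos k a j| ≤ 1 := by
  rw [dumbbell_adj_iff] at h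
  rw [abs_le]
  unfold dumbbellPos
  split_ifs <;> omega

lemma abs_dumbbellPos_sub_le_length {k a b : ℕ} {i j : Fin (2 * k + 1 + a + b)}
    (w : (dumbbell (2 * k + 1 + a + b) a b).Walk i j) :
    |dumbbellPos k a i - dumbbellPos k a j| ≤ w.length := by
  induction w with
  | nil => simp
  | cons h w ih =>
    rw [Walk.length_cons]
    have h1 := abs_dumbbellPos_sub_le_one h
    push_cast
    exact (abs_sub_le _ _ _).trans ((add_le_add h1 ih).trans_eq (add_comm _ _))

/-- From a handle vertex, every vertex is reached by a walk along the handle. -/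
lemma exists_walk_dumbbell (k a b : ℕ) {i : Fin (2 * k + 1 + a + b)} (hi : (i : ℕ) < 2 * k + 1)
    (j : Fin (2 * k + 1 + a + b)) :
    ∃ w : (dumbbell (2 * k + 1 + a + b) a b).Walk i j,
      (w.length : ℤ) = |dumbbellPos k a i - dumbbellPos k a j| := by
  set G := dumbbell (2 * k + 1 + a + b) a b
  let P : ℕ → Fin (2 * k + 1 + a + b) := fun l => ⟨min l (2 * k), by omega⟩
  have hval (l : Fin (2 * k + 1 + a + b)) (hl : (l : ℕ) < 2 * k + 1) : P l = l :=
    Fin.ext (by simp only [P]; omega)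
  have hP : ∀ l < 2 * k, G.Adj (P l) (P (l + 1)) := by
    intro l hl
    rw [dumbbell_adj_iff, ne_eq, Fin.ext_iff]
    simp only [P]
    omega
  have hup {l l' : Fin (2 * k + 1 + a + b)} (h : (l : ℕ) ≤ l') (hl : (l' : ℕ) < 2 * k + 1) :
      ∃ w : G.Walk l l', w.length = (l' : ℕ) - l := by
    have := exists_walk_of_adj_succ hP h (by omega)
    rwa [hval l (by omega), hval l' hl] at this
  have hdown {l l' : Fin (2 * k + 1 + a + b)} (h : (l' : ℕ) ≤ l) (hl : (l : ℕ) < 2 * k + 1) :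
      ∃ w : G.Walk l l', w.length = (l : ℕ) - l' := by
    obtain ⟨w, hw⟩ := hup h hl
    exact ⟨w.reverse, by rw [Walk.length_reverse, hw]⟩
  have hposi : dumbbellPos k a i = i + 1 := if_pos hi
  rw [hposi]
  rcases lt_or_ge (j : ℕ) (2 * k + 1) with hj | hj
  · rw [show dumbbellPos k a j = j + 1 from if_pos hj]
    rcases le_total (i : ℕ) j with h | h
    · obtain ⟨w, hw⟩ := hup h hj
      exact ⟨w, by rw [hw, abs_of_nonpos (by omega)]; omega⟩
    · obtain ⟨w, hw⟩ := hdown h hi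
      exact ⟨w, by rw [hw, abs_of_nonneg (by omega)]; omega⟩
  rcases lt_or_ge (j : ℕ) (2 * k + 1 + a) with hj' | hj'
  · have hpos : dumbbellPos k a j = 0 := by rw [dumbbellPos, if_neg (by omega), if_pos hj']
    obtain ⟨w, hw⟩ := hdown (l' := ⟨0, by omega⟩) (Nat.zero_le _) hi
    have hadj : G.Adj ⟨0, by omega⟩ j := by
      rw [dumbbell_adj_iff, ne_eq, Fin.ext_iff]
      simp only [true_and]
      omega
    refine ⟨w.concat hadj, ?_⟩
    rw [Walk.length_concat, hw, hpos, abs_of_nonneg (by omega)]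
    simp
  · have hpos : dumbbellPos k a j = 2 * k + 2 := by
      rw [dumbbellPos, if_neg (by omega), if_neg (by omega)]
    obtain ⟨w, hw⟩ := hup (l' := ⟨2 * k, by omega⟩) (Nat.lt_succ_iff.mp hi) (Nat.lt_succ_self _)
    have hadj : G.Adj ⟨2 * k, by omega⟩ j := by
      rw [dumbbell_adj_iff, ne_eq, Fin.ext_iff]
      simp only [true_and]
      omega
    refine ⟨w.concat hadj, ?_⟩
    rw [Walk.length_concat, hw, hpos, abs_of_nonpos (by omega)]
    simp only
    omega

lemma connected_dumbbell (k a b : ℕ) : (dumbbell (2 * k + 1 + a + b) a b).Connected := by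
  have hzero (j) : (dumbbell (2 * k + 1 + a + b) a b).Reachable ⟨0, by omega⟩ j :=
    ⟨(exists_walk_dumbbell k a b (i := ⟨0, by omega⟩) (Nat.succ_pos _) j).choose⟩
  have : Nonempty (Fin (2 * k + 1 + a + b)) := ⟨⟨0, by omega⟩⟩
  exact ⟨fun i j => (hzero i).symm.trans (hzero j)⟩

/-- If the two bunches of pendant vertices differ by at most one, no vertex of the dumbbell has
status smaller than the middle of the handle. -/
lemma le_minStatus_dumbbell (k a b : ℕ) (hba : b ≤ a) (hab : a ≤ b + 1) :
    (k + 1) * (k + a + b) ≤ minStatus (dumbbell (2 * k + 1 + a + b) a b) := by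
  have : Nonempty (Fin (2 * k + 1 + a + b)) := ⟨⟨0, by omega⟩⟩
  refine le_minStatus fun u => ?_
  set x := dumbbellPos k a u
  have hle : ∑ v : Fin (2 * k + 1 + a + b), |dumbbellPos k a v - x| ≤
      (status (dumbbell (2 * k + 1 + a + b) a b) u : ℤ) := by
    rw [status, Nat.cast_sum]
    refine Finset.sum_le_sum fun v _ => ?_
    obtain ⟨w, hw⟩ := (connected_dumbbell k a b).exists_walk_length_eq_dist u v
    rw [← hw, abs_sub_comm]
    exact abs_dumbbellPos_sub_le_length w
  rw [sum_dumbbellPos k a b fun y => |y - x|] at hle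
  have hhandle := le_sum_range_abs_sub k (x - 1)
  have hshift (y : ℤ) : y - (x - 1) = y + 1 - x := by ring
  simp only [hshift] at hhandle
  have hends : 2 * (k + 1 : ℤ) ≤ |0 - x| + |2 * k + 2 - x| := by
    rcases abs_cases (0 - x) with h | h <;> rcases abs_cases (2 * k + 2 - x) with h' | h' <;> omega
  have hmid : (k + 1 : ℤ) ≤ |0 - x| + |k + 1 - x| := by
    rcases abs_cases (0 - x) with h | h <;> rcases abs_cases (k + 1 - x) with h' | h' <;> omega
  have hmul := mul_le_mul_of_nonneg_left hends (Int.natCast_nonneg b)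
  zify
  obtain rfl | rfl : a = b ∨ a = b + 1 := by omega
  · have := abs_nonneg (k + 1 - x)
    nlinarith
  · push_cast at hle ⊢
    nlinarith

/-- Moving one step from the middle of the handle towards the larger bunch of pendant vertices. -/
lemma minStatus_dumbbell_le (k a b : ℕ) (hk : 1 ≤ k) :
    (minStatus (dumbbell (2 * k + 1 + a + b) a b) : ℤ) ≤
      (k + 1) * (k + a + b) + 1 + b - a := by
  let u : Fin (2 * k + 1 + a + b) := ⟨k - 1, by omega⟩
  have hu : (u : ℕ) < 2 * k + 1 := by simp only [u]; omega
  have hpos : dumbbellPos k a u = k := by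
    rw [dumbbellPos, if_pos hu]
    simp only [u]
    omega
  have hle : (status (dumbbell (2 * k + 1 + a + b) a b) u : ℤ) ≤
      ∑ v : Fin (2 * k + 1 + a + b), |dumbbellPos k a v - k| := by
    rw [status, Nat.cast_sum]
    refine Finset.sum_le_sum fun v _ => ?_
    obtain ⟨w, hw⟩ := exists_walk_dumbbell k a b hu v
    rw [abs_sub_comm, ← hpos, ← hw]
    exact_mod_cast dist_le w
  have hmin := minStatus_le_status (dumbbell (2 * k + 1 + a + b) a b) u
  zify at hmin
  rw [sum_dumbbellPos k a b fun y => |y - k|] at hle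
  have hhandle := sum_range_abs_sub_eq k (k - 1) (by simp)
  have hshift (y : ℤ) : y - ((k : ℤ) - 1) = y + 1 - k := by ring
  simp only [hshift] at hhandle
  rw [hhandle, show (k : ℤ) + 1 - k = 1 by ring, show |0 - (k : ℤ)| = k by simp,
    show |2 * (k : ℤ) + 2 - k| = k + 2 by rw [abs_of_nonneg (by omega)]; ring, abs_one] at hle
  linarith

/-- With a handle of one vertex the dumbbell is a star, however its leaves are distributed. -/
lemma dumbbell_eq_of_add_eq {n a b a' b' : ℕ} (h : a + b + 1 = n) (h' : a' + b' + 1 = n) :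
    dumbbell n a b = dumbbell n a' b' := by
  ext i j
  simp only [dumbbell, SimpleGraph.fromRel_adj]
  omega

lemma Finset.exists_enumeration [Nonempty V] (A : Finset V) :
    ∃ e : ℕ → V, (∀ i < A.card, e i ∈ A) ∧ ∀ v ∈ A, ∃ i < A.card, e i = v := by
  classical
  refine ⟨fun i => if h : i < A.card then A.equivFin.symm ⟨i, h⟩ else Classical.arbitrary V,
    fun i hi => ?_, fun v hv => ⟨A.equivFin ⟨v, hv⟩, Fin.is_lt _, ?_⟩⟩
  · simp only [hi, dite_true]
    exact Subtype.coe_prop _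
  · simp

/-- A tree is a dumbbell as soon as its vertices split into a path and neighbours of the two ends
of the path. -/
lemma SimpleGraph.IsTree.nonempty_iso_dumbbell [Fintype V] {T : SimpleGraph V} (hT : T.IsTree)
    {k : ℕ} {p : ℕ → V} (hp : ∀ i < 2 * k, T.Adj (p i) (p (i + 1))) {A B : Finset V}
    (hA : ∀ v ∈ A, T.Adj (p 0) v) (hB : ∀ v ∈ B, T.Adj (p (2 * k)) v)
    (hcover : ∀ v, (∃ i ≤ 2 * k, p i = v) ∨ v ∈ A ∨ v ∈ B)
    (hcard : Fintype.card V = 2 * k + 1 + A.card + B.card) :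
    Nonempty (T ≃g dumbbell (2 * k + 1 + A.card + B.card) A.card B.card) := by
  have := hT.connected.nonempty
  obtain ⟨eA, heA, heA'⟩ := A.exists_enumeration
  obtain ⟨eB, heB, heB'⟩ := B.exists_enumeration
  let f : Fin (2 * k + 1 + A.card + B.card) → V := fun i =>
    if (i : ℕ) < 2 * k + 1 then p i
    else if (i : ℕ) < 2 * k + 1 + A.card then eA (i - (2 * k + 1))
    else eB (i - (2 * k + 1 + A.card))
  have hfp {i : Fin (2 * k + 1 + A.card + B.card)} (hi : (i : ℕ) < 2 * k + 1) : f i = p i :=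
    if_pos hi
  have hfA {i : Fin (2 * k + 1 + A.card + B.card)} (h1 : 2 * k + 1 ≤ (i : ℕ))
      (h2 : (i : ℕ) < 2 * k + 1 + A.card) : f i = eA (i - (2 * k + 1)) := by
    simp only [f]
    rw [if_neg (by omega), if_pos h2]
  have hfB {i : Fin (2 * k + 1 + A.card + B.card)} (h : 2 * k + 1 + A.card ≤ (i : ℕ)) :
      f i = eB (i - (2 * k + 1 + A.card)) := by
    simp only [f]
    rw [if_neg (by omega), if_neg (by omega)]
  have hsurj : Function.Surjective f := by
    intro v
    rcases hcover v with ⟨i, hi, rfl⟩ | hv | hv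
    · exact ⟨⟨i, by omega⟩, hfp (Nat.lt_succ_of_le hi)⟩
    · obtain ⟨i, hi, rfl⟩ := heA' v hv
      refine ⟨⟨2 * k + 1 + i, by omega⟩, (hfA (Nat.le_add_right _ _) ?_).trans ?_⟩
      · simp only
        omega
      · simp only [Nat.add_sub_cancel_left]
    · obtain ⟨i, hi, rfl⟩ := heB' v hv
      refine ⟨⟨2 * k + 1 + A.card + i, by omega⟩, (hfB (Nat.le_add_right _ _)).trans ?_⟩
      simp only [Nat.add_sub_cancel_left]
  have hbij : Function.Bijective f :=
    (Fintype.bijective_iff_surjective_and_card f).mpr ⟨hsurj, by rw [Fintype.card_fin, hcard]⟩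
  have hrel {i j : Fin (2 * k + 1 + A.card + B.card)}
      (h : ((i : ℕ) + 1 = j ∧ (j : ℕ) < 2 * k + 1) ∨
        ((i : ℕ) = 0 ∧ 2 * k + 1 ≤ (j : ℕ) ∧ (j : ℕ) < 2 * k + 1 + A.card) ∨
        ((i : ℕ) = 2 * k ∧ 2 * k + 1 + A.card ≤ (j : ℕ))) : T.Adj (f i) (f j) := by
    rcases h with ⟨h1, h2⟩ | ⟨h1, h2, h3⟩ | ⟨h1, h2⟩
    · rw [hfp (i := i) (by omega), hfp h2, ← h1]
      exact hp _ (by omega)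
    · rw [hfp (i := i) (by omega), hfA h2 h3, h1]
      exact hA _ (heA _ (by omega))
    · rw [hfp (i := i) (by omega), hfB h2, h1]
      exact hB _ (heB _ (by omega))
  let e := Equiv.ofBijective f hbij
  let H := (dumbbell (2 * k + 1 + A.card + B.card) A.card B.card).map e.toEmbedding
  let φ : dumbbell (2 * k + 1 + A.card + B.card) A.card B.card ≃g H := Iso.map e _
  have hle : H ≤ T := by
    rw [SimpleGraph.map_le_iff_le_comap]
    intro i j hij
    rw [dumbbell_adj_iff] at hij
    rcases hij.2 with h | h
    · exact hrel h
    · exact (hrel h).symm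
  have heq : H = T := hle.antisymm <|
    (isTree_iff_minimal_connected.mp hT).le_of_le
      (φ.connected_iff.mp (connected_dumbbell k A.card B.card)) hle
  rw [← heq]
  exact ⟨φ.symm⟩

lemma SimpleGraph.IsTree.exists_iso_dumbbell [Fintype V] {T : SimpleGraph V} (hT : T.IsTree)
    {k : ℕ} {p : ℕ → V} (hp : ∀ i < 2 * k, T.Adj (p i) (p (i + 1)))
    (hinj : ∀ i ≤ 2 * k, ∀ j ≤ 2 * k, p i = p j → i = j)
    (hcover : ∀ v, (∃ i ≤ 2 * k, p i = v) ∨ T.Adj (p 0) v ∨ T.Adj (p (2 * k)) v) :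
    ∃ a b, b ≤ a ∧ Fintype.card V = 2 * k + 1 + a + b ∧
      Nonempty (T ≃g dumbbell (2 * k + 1 + a + b) a b) := by
  classical
  let S := (Finset.range (2 * k + 1)).image p
  have hmem (v : V) : v ∈ S ↔ ∃ i ≤ 2 * k, p i = v := by
    simp [S]
  have hS : S.card = 2 * k + 1 := by
    rw [Finset.card_image_of_injOn, Finset.card_range]
    intro i hi j hj
    simp only [Finset.coe_range, Set.mem_Iio] at hi hj
    exact hinj i (by omega) j (by omega)
  let A := Sᶜ.filter (T.Adj (p 0))
  let B := Sᶜ.filter (fun v => ¬ T.Adj (p 0) v)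
  have hA : ∀ v ∈ A, T.Adj (p 0) v := fun v hv => (Finset.mem_filter.mp hv).2
  have hB : ∀ v ∈ B, T.Adj (p (2 * k)) v := by
    intro v hv
    obtain ⟨hvS, hv0⟩ := Finset.mem_filter.mp hv
    rw [Finset.mem_compl, hmem] at hvS
    exact ((hcover v).resolve_left hvS).resolve_left hv0
  have hcov (v : V) : (∃ i ≤ 2 * k, p i = v) ∨ v ∈ A ∨ v ∈ B := by
    rw [← hmem]
    by_cases h1 : v ∈ S <;> by_cases h2 : T.Adj (p 0) v <;> simp [A, B, h1, h2]
  have hcard : Fintype.card V = 2 * k + 1 + A.card + B.card := by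
    rw [← hS, add_assoc, Finset.card_filter_add_card_filter_not, Finset.card_add_card_compl]
  rcases le_total B.card A.card with h | h
  · exact ⟨_, _, h, hcard, hT.nonempty_iso_dumbbell hp hA hB hcov hcard⟩
  · have hcard' : Fintype.card V = 2 * k + 1 + B.card + A.card := by omega
    refine ⟨_, _, h, hcard', hT.nonempty_iso_dumbbell (p := fun i => p (2 * k - i))
      (fun i hi => ?_) hB (by simpa using hA) (fun v => ?_) hcard'⟩
    · have := hp (2 * k - (i + 1)) (by omega)
      rw [show 2 * k - (i + 1) + 1 = 2 * k - i by omega] at this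
      exact this.symm
    · rcases hcov v with ⟨i, hi, rfl⟩ | h | h
      · exact Or.inl ⟨2 * k - i, by omega, by rw [Nat.sub_sub_self hi]⟩
      · exact Or.inr (Or.inr h)
      · exact Or.inr (Or.inl h)

/-- If the middle of a geodesic of length `2 * k + 1` or `2 * k + 2` is at distance exactly `k + 1`
from all vertices off the geodesic, then the tree is a dumbbell. -/
lemma SimpleGraph.IsTree.exists_iso_dumbbell_of_geodesic [Fintype V] {T : SimpleGraph V}
    (hT : T.IsTree) {D k : ℕ} {P : ℕ → V} (hD : k + 1 = (D + 1) / 2)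
    (hadj : ∀ i < D, T.Adj (P i) (P (i + 1)))
    (hdist : ∀ i j, i ≤ j → j ≤ D → T.dist (P i) (P j) = j - i)
    (hoff : ∀ x, (∀ i ≤ D, P i ≠ x) → T.dist (P (k + 1)) x = k + 1) :
    ∃ a b, b ≤ a ∧ Fintype.card V = 2 * k + 1 + a + b ∧
      Nonempty (T ≃g dumbbell (2 * k + 1 + a + b) a b) := by
  refine hT.exists_iso_dumbbell (p := fun i => P (i + 1)) (fun i hi => hadj _ (by omega)) ?_ ?_
  · intro i hi j hj hij
    exact Nat.succ_injective (eq_of_geodesic_eq hdist (by omega) (by omega) hij)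
  · intro v
    by_cases hv : ∃ i ≤ D, P i = v
    · obtain ⟨i, hi, rfl⟩ := hv
      rcases Nat.eq_zero_or_pos i with rfl | h0
      · exact Or.inr (Or.inl (hadj 0 (by omega)).symm)
      rcases le_or_gt i (2 * k + 1) with h | h
      · exact Or.inl ⟨i - 1, by omega, by rw [Nat.sub_add_cancel h0]⟩
      · obtain rfl : i = 2 * k + 1 + 1 := by omega
        exact Or.inr (Or.inr (hadj (2 * k + 1) (by omega)))
    · push Not at hv
      have hdv := hoff v hv
      obtain ⟨w, hw⟩ := hT.connected.exists_walk_length_eq_dist v (P (k + 1))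
      rw [T.dist_comm, hdv] at hw
      cases w with
      | nil => simp at hw
      | @cons _ y _ hvy w =>
        rw [Walk.length_cons] at hw
        have hy := dist_le w
        rw [T.dist_comm] at hy
        obtain ⟨i, hi, rfl⟩ : ∃ i ≤ D, P i = y := by
          by_contra! h
          have := hoff y h
          omega
        have hy' := hT.connected.dist_triangle (u := P (k + 1)) (v := P i) (w := v)
        rw [dist_eq_one_iff_adj.mpr hvy.symm, hdv] at hy'
        have : i = 1 ∨ i = 2 * k + 1 := by
          rcases le_total (k + 1) i with h | h
          · have := hdist _ _ h hi
            omega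
          · have := hdist _ _ h (by omega)
            rw [T.dist_comm] at this
            omega
        rcases this with rfl | rfl
        · exact Or.inr (Or.inl hvy.symm)
        · exact Or.inr (Or.inr hvy.symm)

/-- Upper bound on the minimum status of a tree with given order and matching
number, with equality iff `T ≅ D_n(⌈(n+1)/2⌉ - m, ⌊(n+1)/2⌋ - m)`. -/
theorem stmt5 [Fintype V] (T : SimpleGraph V) (n m : ℕ)
    (hn : Fintype.card V = n) (h4 : 4 ≤ n) (hT : T.IsTree)
    (hm : matchingNumber T = m) (hm1 : 1 ≤ m) (hm2 : 2 * m ≤ n) :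
    minStatus T ≤ m * (n - m) ∧
      (minStatus T = m * (n - m) ↔
        Nonempty (T ≃g dumbbell n ((n + 2) / 2 - m) ((n + 1) / 2 - m))) := by
  obtain ⟨D, P, hadj, hdist, hecc⟩ := hT.exists_diametral_geodesic
  obtain ⟨hle, heq⟩ := status_le_of_geodesic rfl hdist hecc
  have hmin := minStatus_le_status T (P ((D + 1) / 2))
  have hRm : (D + 1) / 2 ≤ m := by
    rw [← hm]
    exact le_matchingNumber (P := P) (fun i hi => hadj _ (by omega))
      fun i hi j hj => eq_of_geodesic_eq hdist (by omega) (by omega)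
  rw [hn] at hle heq
  obtain ⟨k, rfl⟩ : ∃ k, m = k + 1 := ⟨m - 1, by omega⟩
  have hRn : (D + 1) / 2 * (n - (D + 1) / 2) ≤ (k + 1) * (n - (k + 1)) := by
    obtain ⟨d, hd⟩ := Nat.exists_eq_add_of_le hRm
    obtain ⟨t, rfl⟩ := Nat.exists_eq_add_of_le hm2
    rw [show 2 * (k + 1) + t - (D + 1) / 2 = k + 1 + d + t by omega,
      show 2 * (k + 1) + t - (k + 1) = k + 1 + t by omega]
    nlinarith
  refine ⟨by omega, fun h => ?_, fun ⟨e⟩ => le_antisymm (by omega) ?_⟩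
  · have hR : k + 1 = (D + 1) / 2 := by
      by_contra hne
      obtain ⟨d, hd⟩ := Nat.exists_eq_add_of_lt (lt_of_le_of_ne hRm (Ne.symm hne))
      obtain ⟨t, rfl⟩ := Nat.exists_eq_add_of_le hm2
      have hge := h.symm.le.trans (hmin.trans hle)
      rw [show 2 * (k + 1) + t - (D + 1) / 2 = k + 1 + d + 1 + t by omega,
        show 2 * (k + 1) + t - (k + 1) = k + 1 + t by omega] at hge
      nlinarith
    rw [← hR] at hle heq hmin
    obtain ⟨a, b, hba, hcard, ⟨e⟩⟩ :=
      hT.exists_iso_dumbbell_of_geodesic hR hadj hdist (heq (by omega))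
    obtain rfl : n = 2 * k + 1 + a + b := by omega
    rcases Nat.eq_zero_or_pos k with rfl | hk
    · rw [dumbbell_eq_of_add_eq (a := a) (b := b) (by omega)
        (a' := (2 * 0 + 1 + a + b + 2) / 2 - (0 + 1))
        (b' := (2 * 0 + 1 + a + b + 1) / 2 - (0 + 1)) (by omega)] at e
      exact ⟨e⟩
    · have hbal := minStatus_dumbbell_le k a b hk
      rw [← minStatus_eq_of_iso hT.connected e, h,
        show 2 * k + 1 + a + b - (k + 1) = k + a + b by omega] at hbal
      push_cast at hbal
      have hab : a ≤ b + 1 := by omega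
      rw [show (2 * k + 1 + a + b + 2) / 2 - (k + 1) = a by omega,
        show (2 * k + 1 + a + b + 1) / 2 - (k + 1) = b by omega]
      exact ⟨e⟩
  · rw [minStatus_eq_of_iso hT.connected e]
    generalize ha : (n + 2) / 2 - (k + 1) = a
    generalize hb : (n + 1) / 2 - (k + 1) = b
    obtain rfl : n = 2 * k + 1 + a + b := by omega
    rw [show 2 * k + 1 + a + b - (k + 1) = k + a + b by omega]
    exact le_minStatus_dumbbell k a b (by omega) (by omega)
end

section
/- Let T be a tree on n vertices with domination number gamma, where ceil(n/3) < gamma <= floor(n/2). Then s(T) <= 3*n*gamma + 3*gamma - n - ceil((n^2 + 18*gamma^2)/4), with equality if and only if T is isomorphic to the caterpillar C_n(ceil((3*gamma - n)/2), floor((3*gamma - n)/2)). -/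
open SimpleGraph

variable {V : Type*}

namespace SimpleGraph

variable {G : SimpleGraph V}

/-- `l` is a leaf of `G` whose only neighbour is `s`. -/
def IsLeafAt (G : SimpleGraph V) (s l : V) : Prop :=
  G.Adj s l ∧ ∀ x, G.Adj l x → x = s

lemma Connected.exists_adj_dist_add_one_eq (hG : G.Connected) {c v : V} (h : v ≠ c) :
    ∃ u, G.Adj v u ∧ G.dist c u + 1 = G.dist c v := by
  obtain ⟨p, hp⟩ := hG.exists_walk_length_eq_dist v c
  cases p with
  | nil => exact absurd rfl h
  | @cons _ u _ huv q =>
    refine ⟨u, huv, ?_⟩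
    have h₁ : G.dist u c ≤ q.length := dist_le q
    have h₂ : G.dist v c ≤ G.dist v u + G.dist u c := hG.dist_triangle
    rw [dist_eq_one_iff_adj.mpr huv] at h₂
    rw [Walk.length_cons] at hp
    rw [dist_comm (u := c), dist_comm (u := c)]
    omega

lemma IsTree.eq_of_adj_of_dist_add_one_eq (hG : G.IsTree) {c v u u' : V}
    (h : G.Adj v u) (h' : G.Adj v u')
    (hd : G.dist c u + 1 = G.dist c v) (hd' : G.dist c u' + 1 = G.dist c v) : u = u' := by
  obtain ⟨p, hp⟩ := hG.connected.exists_walk_length_eq_dist u c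
  obtain ⟨p', hp'⟩ := hG.connected.exists_walk_length_eq_dist u' c
  have e := (hG.existsUnique_path v c).unique
    (Walk.isPath_of_length_eq_dist (.cons h p) (by
      rw [Walk.length_cons, hp, dist_comm, hd, dist_comm]))
    (Walk.isPath_of_length_eq_dist (.cons h' p') (by
      rw [Walk.length_cons, hp', dist_comm, hd', dist_comm]))
  exact (Walk.cons.inj e).1

lemma IsTree.dist_add_one_eq_or (hG : G.IsTree) (c : V) {u v : V} (h : G.Adj u v) :
    G.dist c u + 1 = G.dist c v ∨ G.dist c v + 1 = G.dist c u := by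
  rcases hG.dist_eq_dist_add_one_of_adj c h with h | h <;> omega

/-- A vertex without neighbours farther from the root `c` is a leaf. -/
lemma IsTree.exists_isLeafAt_of_forall_adj (hG : G.IsTree) {c v : V} (hv : v ≠ c)
    (h : ∀ u, G.Adj v u → G.dist c u ≠ G.dist c v + 1) :
    ∃ s, G.IsLeafAt s v ∧ G.dist c s + 1 = G.dist c v := by
  obtain ⟨s, hs, hd⟩ := hG.connected.exists_adj_dist_add_one_eq hv
  refine ⟨s, ⟨hs.symm, fun x hx ↦ ?_⟩, hd⟩
  have := h x hx
  have := hG.dist_add_one_eq_or c hx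
  exact hG.eq_of_adj_of_dist_add_one_eq hx hs (by omega) hd

lemma IsTree.exists_isLeafAt [Finite V] [Nontrivial V] (hG : G.IsTree) :
    ∃ s l, G.IsLeafAt s l := by
  obtain ⟨c, d, hcd⟩ := exists_pair_ne V
  obtain ⟨v, hv⟩ := Finite.exists_max (G.dist c)
  have hvc : v ≠ c := by
    rintro rfl
    have := hv d
    have := hG.connected.pos_dist_of_ne hcd
    simp only [dist_self] at *
    omega
  obtain ⟨s, hs, -⟩ := hG.exists_isLeafAt_of_forall_adj hvc fun u _ hu ↦ by
    have := hv u
    omega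
  exact ⟨s, v, hs⟩

open Classical in
/-- Three times the domination number of a tree is at most the number of vertices plus the
number of support vertices. -/
lemma IsTree.three_mul_domNumber_le [Fintype V] [Nontrivial V] (hG : G.IsTree) :
    3 * domNumber G ≤ Fintype.card V + (Finset.univ.filter fun s ↦ ∃ l, G.IsLeafAt s l).card := by
  obtain ⟨r, l, hr⟩ := hG.exists_isLeafAt
  set Q := Finset.univ.filter fun s ↦ ∃ l, G.IsLeafAt s l with hQ
  let A (i : ℕ) : Finset V := Finset.univ.filter fun v ↦ G.dist r v % 3 = i
  let B (i : ℕ) : Finset V := Q.filter fun v ↦ G.dist r v % 3 = i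
  have hdom (i j : ℕ) (hi : i < 3) (hj : j = (i + 1) % 3) :
      domNumber G ≤ (A i).card + (B j).card := by
    have hle : domNumber G ≤ ((A i ∪ B j : Finset V) : Set V).ncard := by
      refine Nat.sInf_le ⟨_, fun v hv ↦ ?_, rfl⟩
      simp only [Finset.coe_union, Set.mem_union, Finset.mem_coe, not_or, A, B,
        Finset.mem_filter, Finset.mem_univ, true_and, hQ] at hv
      obtain ⟨hvA, hvB⟩ := hv
      simp only [Finset.coe_union, Set.mem_union, Finset.mem_coe, A, B,
        Finset.mem_filter, Finset.mem_univ, true_and, hQ]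
      by_cases hvj : G.dist r v % 3 = j
      · have hvr : v ≠ r := by
          rintro rfl
          exact hvB ⟨⟨l, hr⟩, hvj⟩
        obtain ⟨u, hu, hd⟩ := hG.connected.exists_adj_dist_add_one_eq hvr
        exact ⟨u, Or.inl (by omega), hu.symm⟩
      · by_cases hc : ∃ u, G.Adj v u ∧ G.dist r u = G.dist r v + 1
        · obtain ⟨u, hu, hd⟩ := hc
          exact ⟨u, Or.inl (by omega), hu.symm⟩
        · push Not at hc
          have hvr : v ≠ r := by
            rintro rfl
            exact hc l hr.1 (by simp [dist_eq_one_iff_adj.mpr hr.1])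
          obtain ⟨s, hs, hd⟩ := hG.exists_isLeafAt_of_forall_adj hvr hc
          exact ⟨s, Or.inr ⟨⟨v, hs⟩, by omega⟩, hs.1⟩
    rw [Set.ncard_coe_finset] at hle
    exact hle.trans (Finset.card_union_le _ _)
  have hsplit (s : Finset V) : (s.filter fun v ↦ G.dist r v % 3 = 0).card +
      (s.filter fun v ↦ G.dist r v % 3 = 1).card +
      (s.filter fun v ↦ G.dist r v % 3 = 2).card = s.card := by
    rw [Finset.card_eq_sum_card_fiberwise (s := s) (f := fun v ↦ G.dist r v % 3)
      (t := Finset.range 3) fun v _ ↦ by simp [Nat.mod_lt]]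
    simp [Finset.sum_range_succ]
  have h0 := hdom 0 1 (by norm_num) rfl
  have h1 := hdom 1 2 (by norm_num) rfl
  have h2 := hdom 2 0 (by norm_num) rfl
  have hA := hsplit Finset.univ
  have hB := hsplit Q
  rw [Finset.card_univ] at hA
  simp only [A, B] at h0 h1 h2
  omega

end SimpleGraph

section Layered

variable {α : Type*}

/-- The values of the depth function `d` on `P` are positive and form an initial segment. -/
def IsLayered (d : α → ℕ) (P : Finset α) : Prop :=
  ∀ v ∈ P, 1 ≤ d v ∧ (2 ≤ d v → ∃ u ∈ P, d u + 1 = d v)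

lemma IsLayered.le_card {d : α → ℕ} {P : Finset α} (hP : IsLayered d P) {v : α} (hv : v ∈ P) :
    d v ≤ P.card := by
  have key (j : ℕ) : ∀ v ∈ P, d v = j → Finset.Icc 1 j ⊆ P.image d := by
    induction j with
    | zero => simp
    | succ j ih =>
      intro v hv hj i hi
      rw [Finset.mem_Icc] at hi
      rcases hi.2.eq_or_lt with rfl | hij
      · exact Finset.mem_image.mpr ⟨v, hv, hj⟩
      · obtain ⟨u, hu, hud⟩ := (hP v hv).2 (by omega)
        exact ih u hu (by omega) (Finset.mem_Icc.mpr (by omega))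
  simpa using (Finset.card_le_card (key _ v hv rfl)).trans Finset.card_image_le

/-- Twice the largest possible weighted sum of depths of a layered set of `m` elements of weight
`1` or `2` and total weight `W`. -/
def layeredBound (W m : ℤ) : ℤ := W * (W + 1) - 2 * (W - m) ^ 2

lemma layeredBound_add_one (W m : ℤ) :
    layeredBound (W + 1) (m + 1) = layeredBound W m + 2 * (W + 1) := by
  unfold layeredBound
  ring

lemma layeredBound_add_two (W m : ℤ) :
    layeredBound (W + 2) (m + 1) = layeredBound W m + 4 * (m + 1) := by
  unfold layeredBound
  ring

lemma card_le_sum_weight {w : α → ℕ} {P : Finset α} (hw : ∀ v ∈ P, w v = 1 ∨ w v = 2) :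
    P.card ≤ ∑ v ∈ P, w v := by
  rw [Finset.card_eq_sum_ones]
  exact Finset.sum_le_sum fun v hv ↦ by have := hw v hv; omega

lemma sum_weight_le_two_mul_card {w : α → ℕ} {P : Finset α} (hw : ∀ v ∈ P, w v = 1 ∨ w v = 2) :
    ∑ v ∈ P, w v ≤ 2 * P.card := by
  rw [mul_comm, ← smul_eq_mul, ← Finset.sum_const]
  exact Finset.sum_le_sum fun v hv ↦ by have := hw v hv; omega

lemma IsLayered.two_mul_sum_le_and {d w : α → ℕ} {P : Finset α} (hP : IsLayered d P)
    (hw : ∀ v ∈ P, w v = 1 ∨ w v = 2) :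
    2 * ((∑ v ∈ P, w v * d v : ℕ) : ℤ) ≤ layeredBound (∑ v ∈ P, w v : ℕ) P.card ∧
      (2 * ((∑ v ∈ P, w v * d v : ℕ) : ℤ) = layeredBound (∑ v ∈ P, w v : ℕ) P.card →
        Set.InjOn d P ∧ ∀ v ∈ P, (w v = 2 ↔ 2 * P.card < d v + ∑ v ∈ P, w v)) := by
  classical
  induction P using Finset.induction_on_max_value d with
  | empty => simp [layeredBound]
  | insert a s has hmax ih =>
    have hs : IsLayered d s := by
      intro v hv
      refine ⟨(hP v (Finset.mem_insert_of_mem hv)).1, fun h2 ↦ ?_⟩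
      obtain ⟨u, hu, hud⟩ := (hP v (Finset.mem_insert_of_mem hv)).2 h2
      rcases Finset.mem_insert.mp hu with rfl | hu
      · have := hmax v hv
        omega
      · exact ⟨u, hu, hud⟩
    have hws : ∀ v ∈ s, w v = 1 ∨ w v = 2 := fun v hv ↦ hw v (Finset.mem_insert_of_mem hv)
    obtain ⟨ih₁, ih₂⟩ := ih hs hws
    have hda : d a ≤ s.card + 1 := by
      simpa [has] using hP.le_card (Finset.mem_insert_self a s)
    have hsW := card_le_sum_weight hws
    have hlt (h : d a = s.card + 1) (v : α) (hv : v ∈ s) : d v < d a := by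
      have := hs.le_card hv
      omega
    have hinj (h : d a = s.card + 1) (hs' : Set.InjOn d s) :
        Set.InjOn d (insert a (s : Set α)) := by
      rw [Set.injOn_insert (by simpa using has)]
      refine ⟨hs', ?_⟩
      rintro ⟨v, hv, hva⟩
      exact (hlt h v hv).ne hva
    rw [Finset.sum_insert has, Finset.sum_insert has, Finset.card_insert_of_notMem has]
    rcases hw a (Finset.mem_insert_self a s) with ha | ha
    · rw [ha, add_comm 1, one_mul]
      push_cast
      push_cast at ih₁ ih₂
      rw [layeredBound_add_one]
      refine ⟨by linarith, fun heq ↦ ?_⟩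
      have h₁ : d a = s.card + 1 := by zify; zify at hda hsW; linarith
      have h₂ : ∑ v ∈ s, w v = s.card := by zify; zify at hda hsW; linarith
      obtain ⟨hi, hj⟩ := ih₂ (by zify at hda hsW; linarith)
      refine ⟨hinj h₁ hi, fun v hv ↦ ?_⟩
      rcases Finset.mem_insert.mp hv with rfl | hv
      · omega
      · rw [hj v hv]
        have := hs.le_card hv
        omega
    · rw [ha, add_comm 2]
      push_cast
      push_cast at ih₁ ih₂
      rw [layeredBound_add_two]
      refine ⟨by linarith, fun heq ↦ ?_⟩
      have h₁ : d a = s.card + 1 := by zify; zify at hda hsW; linarith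
      obtain ⟨hi, hj⟩ := ih₂ (by zify at hda hsW; linarith)
      refine ⟨hinj h₁ hi, fun v hv ↦ ?_⟩
      rcases Finset.mem_insert.mp hv with rfl | hv
      · omega
      · rw [hj v hv]
        omega

/-- Elements whose depth is at most the size of two layered sets can be distributed among the two
sets so that the total weights stay balanced. -/
lemma exists_layeredBound_absorb {d w : α → ℕ} (O : Finset α) (hw : ∀ v ∈ O, w v = 1 ∨ w v = 2)
    {n W₁ m₁ W₂ m₂ : ℤ} (hd₁ : ∀ v ∈ O, d v ≤ m₁) (hd₂ : ∀ v ∈ O, d v ≤ m₂)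
    (hW₁ : m₁ ≤ W₁) (hW₁' : W₁ ≤ 2 * m₁) (hW₂ : m₂ ≤ W₂) (hW₂' : W₂ ≤ 2 * m₂)
    (hn₁ : 2 * W₁ ≤ n) (hn₂ : 2 * W₂ ≤ n) (hn : W₁ + W₂ + (∑ v ∈ O, w v : ℕ) + 1 ≤ n) :
    ∃ W₁' m₁' W₂' m₂' : ℤ, W₁' + W₂' = W₁ + W₂ + (∑ v ∈ O, w v : ℕ) ∧
      m₁' + m₂' = m₁ + m₂ + O.card ∧ m₁ ≤ m₁' ∧ m₂ ≤ m₂' ∧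
      m₁' ≤ W₁' ∧ W₁' ≤ 2 * m₁' ∧ m₂' ≤ W₂' ∧ W₂' ≤ 2 * m₂' ∧
      layeredBound W₁ m₁ + layeredBound W₂ m₂ + 2 * (∑ v ∈ O, w v * d v : ℕ) +
        2 * (∑ v ∈ O, w v : ℕ) ≤ layeredBound W₁' m₁' + layeredBound W₂' m₂' ∧
      (2 * W₁' ≤ n ∧ 2 * W₂' ≤ n ∨ |W₁' - W₂'| ≤ 2 ∧ 2 ≤ ∑ v ∈ O, w v) := by
  classical
  induction O using Finset.induction_on with
  | empty => exact ⟨W₁, m₁, W₂, m₂, by simp [*]⟩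
  | insert a s has ih =>
    rw [Finset.sum_insert has] at hn ⊢
    rw [Finset.sum_insert has, Finset.card_insert_of_notMem has]
    have ha₁ := hd₁ a (Finset.mem_insert_self a s)
    have ha₂ := hd₂ a (Finset.mem_insert_self a s)
    have hwa := hw a (Finset.mem_insert_self a s)
    obtain ⟨X₁, k₁, X₂, k₂, hX, hk, hk₁, hk₂, h₁, h₁', h₂, h₂', hsum, hbal⟩ :=
      ih (fun v hv ↦ hw v (Finset.mem_insert_of_mem hv))
        (fun v hv ↦ hd₁ v (Finset.mem_insert_of_mem hv))
        (fun v hv ↦ hd₂ v (Finset.mem_insert_of_mem hv)) (by push_cast at hn ⊢; omega)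
    simp only [abs_le] at hbal ⊢
    rcases hwa with hwa | hwa <;> rw [hwa] at hn ⊢ <;> push_cast at hn hsum hX ⊢
    · rcases le_total X₁ X₂ with hle | hle
      · refine ⟨X₁ + 1, k₁ + 1, X₂, k₂, by omega, by omega, by omega, by omega, by omega,
          by omega, by omega, by omega, ?_, by omega⟩
        rw [layeredBound_add_one]
        linarith
      · refine ⟨X₁, k₁, X₂ + 1, k₂ + 1, by omega, by omega, by omega, by omega, by omega,
          by omega, by omega, by omega, ?_, by omega⟩
        rw [layeredBound_add_one]
        linarith
    · rcases le_total X₁ X₂ with hle | hle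
      · refine ⟨X₁ + 2, k₁ + 1, X₂, k₂, by omega, by omega, by omega, by omega, by omega,
          by omega, by omega, by omega, ?_, by omega⟩
        rw [layeredBound_add_two]
        linarith
      · refine ⟨X₁, k₁, X₂ + 2, k₂ + 1, by omega, by omega, by omega, by omega, by omega,
          by omega, by omega, by omega, ?_, by omega⟩
        rw [layeredBound_add_two]
        linarith

end Layered

/-- The extremal problem for two balanced layered sets around a centre of weight `w₀`, where `k`
is the number of elements of weight `2` and `t` is the slack. -/
lemma four_mul_le_of_layeredBound {n k w₀ W₁ m₁ W₂ m₂ S t : ℤ} (hw₀ : w₀ = 1 ∨ w₀ = 2)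
    (hW : W₁ + W₂ + w₀ = n) (hm : m₁ + m₂ + 1 = n - k)
    (h₁ : m₁ ≤ W₁) (h₁' : W₁ ≤ 2 * m₁) (h₂ : m₂ ≤ W₂) (h₂' : W₂ ≤ 2 * m₂)
    (hS : 2 * S + 2 * t ≤ layeredBound W₁ m₁ + layeredBound W₂ m₂) (ht : 0 ≤ t)
    (hbal : 2 * W₁ ≤ n ∧ 2 * W₂ ≤ n ∨ |W₁ - W₂| ≤ 2 ∧ 2 ≤ t) :
    4 * S ≤ n ^ 2 - 2 * k ^ 2 ∧
      (n ^ 2 - 2 * k ^ 2 < 4 * S + 4 → t = 0 ∧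
        (w₀ = 1 ∧ |(W₁ - m₁) - (W₂ - m₂)| ≤ 1 ∨
          w₀ = 2 ∧ W₁ = 2 * m₁ ∧ |(W₁ - m₁ + 1) - (W₂ - m₂)| ≤ 1 ∨
          w₀ = 2 ∧ W₂ = 2 * m₂ ∧ |(W₁ - m₁) - (W₂ - m₂ + 1)| ≤ 1)) := by
  obtain ⟨e, he⟩ : ∃ e, e = (W₁ - m₁) - (W₂ - m₂) := ⟨_, rfl⟩
  obtain ⟨δ, hδ⟩ : ∃ δ, δ = W₁ - W₂ := ⟨_, rfl⟩
  rw [← hδ, abs_le] at hbal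
  simp only [abs_le]
  rcases hw₀ with rfl | rfl
  · have key : 2 * (layeredBound W₁ m₁ + layeredBound W₂ m₂) =
        n ^ 2 - 2 * k ^ 2 - 1 + δ ^ 2 - 2 * e ^ 2 := by
      obtain rfl : k = n - (m₁ + m₂ + 1) := by omega
      subst he hδ hW
      unfold layeredBound
      ring
    have hδ' : -2 ≤ δ ∧ δ ≤ 2 := by omega
    have he0 := sq_nonneg e
    have hδt : δ ^ 2 ≤ 1 ∨ δ ^ 2 ≤ 4 ∧ 2 ≤ t := by
      rcases hbal with hbal | hbal
      · left
        nlinarith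
      · right
        exact ⟨by nlinarith, hbal.2⟩
    refine ⟨by omega, fun hlt ↦ ⟨by omega, Or.inl ⟨rfl, ?_⟩⟩⟩
    have := abs_lt_of_sq_lt_sq' (a := e) (b := 2) (by omega) (by norm_num)
    omega
  · obtain ⟨r₁, hr₁⟩ : ∃ r, r = 2 * m₁ - W₁ := ⟨_, rfl⟩
    obtain ⟨r₂, hr₂⟩ : ∃ r, r = 2 * m₂ - W₂ := ⟨_, rfl⟩
    have key : 2 * (layeredBound W₁ m₁ + layeredBound W₂ m₂) =
        n ^ 2 - 2 * k ^ 2 - 2 * (r₁ + r₂) + δ ^ 2 - 2 - 2 * e ^ 2 := by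
      obtain rfl : k = n - (m₁ + m₂ + 1) := by omega
      subst he hδ hW hr₁ hr₂
      unfold layeredBound
      ring
    have hδe : δ = r₁ - r₂ + 2 * e := by omega
    have hδl : -2 ≤ δ := by omega
    have hδu : δ ≤ 2 := by omega
    have hr₁0 : 0 ≤ r₁ := by omega
    have hr₂0 : 0 ≤ r₂ := by omega
    have hle : δ ^ 2 ≤ 2 + 2 * e ^ 2 + 2 * (r₁ + r₂) := by
      rcases eq_or_ne e 0 with rfl | he0
      · interval_cases δ <;> omega
      · have : 0 < e ^ 2 := by positivity
        interval_cases δ <;> omega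
    refine ⟨by omega, fun hlt ↦ ⟨by omega, Or.inr ?_⟩⟩
    have hlt' : 2 * (r₁ + r₂) + 2 * e ^ 2 < 2 + δ ^ 2 := by omega
    have hδ4 : δ ^ 2 ≤ 4 := by interval_cases δ <;> norm_num
    obtain ⟨hel, heu⟩ := abs_lt_of_sq_lt_sq' (a := e) (b := 2) (by omega) (by norm_num)
    interval_cases e <;> interval_cases δ <;> omega

section Layered

variable {α : Type*}

lemma exists_layeredBound_eq (W m : ℤ) : ∃ e, layeredBound W m = 2 * e := by
  obtain ⟨r, hr⟩ := (Int.even_mul_succ_self W).two_dvd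
  exact ⟨r - (W - m) ^ 2, by rw [layeredBound, hr]; ring⟩

/-- The extremal problem for two layered sets `P₁`, `P₂` and a set `O` of elements of small depth
around a centre of weight `w₀`. -/
lemma IsLayered.four_mul_sum_le_and {d w : α → ℕ} {P₁ P₂ O : Finset α} (hP₁ : IsLayered d P₁)
    (hP₂ : IsLayered d P₂) (hw : ∀ v, w v = 1 ∨ w v = 2) (hO₁ : ∀ v ∈ O, d v ≤ P₁.card)
    (hO₂ : ∀ v ∈ O, d v ≤ P₂.card) {n k w₀ : ℕ} (hw₀ : w₀ = 1 ∨ w₀ = 2)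
    (hn₁ : 2 * ∑ v ∈ P₁, w v ≤ n) (hn₂ : 2 * ∑ v ∈ P₂, w v ≤ n)
    (hW : ∑ v ∈ P₁, w v + ∑ v ∈ P₂, w v + ∑ v ∈ O, w v + w₀ = n)
    (hm : P₁.card + P₂.card + O.card + 1 + k = n) {S : ℤ}
    (hS : S = (∑ v ∈ P₁, w v * d v : ℕ) + (∑ v ∈ P₂, w v * d v : ℕ) +
      (∑ v ∈ O, w v * d v : ℕ)) :
    4 * S ≤ n ^ 2 - 2 * k ^ 2 ∧
      ((n : ℤ) ^ 2 - 2 * k ^ 2 < 4 * S + 4 → O = ∅ ∧ Set.InjOn d P₁ ∧ Set.InjOn d P₂ ∧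
        (∀ v ∈ P₁, (w v = 2 ↔ 2 * P₁.card < d v + ∑ v ∈ P₁, w v)) ∧
        (∀ v ∈ P₂, (w v = 2 ↔ 2 * P₂.card < d v + ∑ v ∈ P₂, w v)) ∧
        ∃ a b, ∑ v ∈ P₁, w v = P₁.card + a ∧ ∑ v ∈ P₂, w v = P₂.card + b ∧
          (w₀ = 1 ∧ a ≤ b + 1 ∧ b ≤ a + 1 ∨
            w₀ = 2 ∧ a = P₁.card ∧ a ≤ b ∧ b ≤ a + 2 ∨
            w₀ = 2 ∧ b = P₂.card ∧ b ≤ a ∧ a ≤ b + 2)) := by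
  obtain ⟨hB₁, hE₁⟩ := hP₁.two_mul_sum_le_and fun v _ ↦ hw v
  obtain ⟨hB₂, hE₂⟩ := hP₂.two_mul_sum_le_and fun v _ ↦ hw v
  have hl₁ := card_le_sum_weight (P := P₁) fun v _ ↦ hw v
  have hu₁ := sum_weight_le_two_mul_card (P := P₁) fun v _ ↦ hw v
  have hl₂ := card_le_sum_weight (P := P₂) fun v _ ↦ hw v
  have hu₂ := sum_weight_le_two_mul_card (P := P₂) fun v _ ↦ hw v
  have hlO := card_le_sum_weight (P := O) fun v _ ↦ hw v
  obtain ⟨e₁, he₁⟩ := exists_layeredBound_eq (∑ v ∈ P₁, w v : ℕ) P₁.card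
  obtain ⟨e₂, he₂⟩ := exists_layeredBound_eq (∑ v ∈ P₂, w v : ℕ) P₂.card
  obtain ⟨W₁, m₁, W₂, m₂, hW', hm', -, -, h₁, h₁', h₂, h₂', hsum, hbal⟩ :=
    exists_layeredBound_absorb (d := d) O (fun v _ ↦ hw v) (n := n)
      (W₁ := (∑ v ∈ P₁, w v : ℕ)) (m₁ := P₁.card) (W₂ := (∑ v ∈ P₂, w v : ℕ)) (m₂ := P₂.card)
      (fun v hv ↦ by exact_mod_cast hO₁ v hv) (fun v hv ↦ by exact_mod_cast hO₂ v hv)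
      (by omega) (by omega) (by omega) (by omega) (by omega) (by omega) (by omega)
  obtain ⟨hle, hlt⟩ := four_mul_le_of_layeredBound (n := n) (k := k) (w₀ := w₀) (S := S)
    (t := (∑ v ∈ O, w v : ℕ)) (by omega) (by omega) (by omega) h₁ h₁' h₂ h₂' (by omega)
    (by omega) (by omega)
  refine ⟨hle, fun h ↦ ?_⟩
  have hO : O = ∅ := by
    rw [← Finset.card_eq_zero]
    have := (hlt h).1
    omega
  subst hO
  simp only [Finset.sum_empty, Finset.card_empty] at hW hm hS
  obtain ⟨-, hlt⟩ := four_mul_le_of_layeredBound (n := n) (k := k) (w₀ := w₀) (S := S)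
    (W₁ := (∑ v ∈ P₁, w v : ℕ)) (m₁ := P₁.card) (W₂ := (∑ v ∈ P₂, w v : ℕ)) (m₂ := P₂.card)
    (t := e₁ + e₂ - S) (by omega) (by omega) (by omega) (by omega) (by omega) (by omega)
    (by omega) (by omega) (by omega) (by omega)
  obtain ⟨ht, hcase⟩ := hlt h
  obtain ⟨hi₁, hw₁⟩ := hE₁ (by omega)
  obtain ⟨hi₂, hw₂⟩ := hE₂ (by omega)
  refine ⟨rfl, hi₁, hi₂, hw₁, hw₂, ∑ v ∈ P₁, w v - P₁.card, ∑ v ∈ P₂, w v - P₂.card,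
    by omega, by omega, ?_⟩
  simp only [abs_le] at hcase
  omega

end Layered

namespace SimpleGraph

variable {G : SimpleGraph V}

/-- A graph consisting of a path, with coordinates `pos`, and of leaves attached to the first `p`
and the last `q` vertices of the path is a caterpillar. -/
lemma nonempty_iso_caterpillar [Fintype V] {n p q : ℕ} (hn : Fintype.card V = n)
    (hpq : 2 * (p + q) ≤ n) {Q : Finset V} {ℓ : V → V} (hℓ : ∀ s ∈ Q, G.IsLeafAt s (ℓ s))
    (hℓQ : ∀ s ∈ Q, ∀ s' ∈ Q, ℓ s' ≠ s) {pos : V → ℕ}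
    (hlt : ∀ v, (∀ s ∈ Q, ℓ s ≠ v) → pos v < n - p - q)
    (hinj : ∀ u v, (∀ s ∈ Q, ℓ s ≠ u) → (∀ s ∈ Q, ℓ s ≠ v) → pos u = pos v → u = v)
    (hadj : ∀ u v, (∀ s ∈ Q, ℓ s ≠ u) → (∀ s ∈ Q, ℓ s ≠ v) →
      (G.Adj u v ↔ pos u + 1 = pos v ∨ pos v + 1 = pos u))
    (hQ : ∀ v, (∀ s ∈ Q, ℓ s ≠ v) → (v ∈ Q ↔ pos v < p ∨ n - p - q ≤ pos v + q)) :
    Nonempty (G ≃g caterpillar n p q) := by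
  classical
  let lab (s : V) : ℕ := if pos s < p then n - p - q + pos s else pos s + p + q
  let g (v : V) : ℕ := if h : ∃ s ∈ Q, ℓ s = v then lab h.choose else pos v
  have hgpos (v : V) (hv : ∀ s ∈ Q, ℓ s ≠ v) : g v = pos v := by
    have : ¬ ∃ s ∈ Q, ℓ s = v := by simpa using hv
    simp only [g, dif_neg this]
  have hglab (s : V) (hs : s ∈ Q) : g (ℓ s) = lab s := by
    have h : ∃ s' ∈ Q, ℓ s' = ℓ s := ⟨s, hs, rfl⟩
    have h' : h.choose = s := by
      refine (hℓ s hs).2 _ ?_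
      have := (hℓ _ h.choose_spec.1).1.symm
      rwa [h.choose_spec.2] at this
    simp only [g, dif_pos h, h']
  have hlab (s : V) (hs : s ∈ Q) : pos s < n - p - q ∧
      (pos s < p ∧ lab s = n - p - q + pos s ∨
        n - p - q ≤ pos s + q ∧ p ≤ pos s ∧ lab s = pos s + p + q) := by
    have h₁ := hlt s (hℓQ s hs)
    have h₂ := (hQ s (hℓQ s hs)).mp hs
    simp only [lab]
    split_ifs <;> omega
  have hcases (v : V) : (∀ s ∈ Q, ℓ s ≠ v) ∨ ∃ s ∈ Q, v = ℓ s := by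
    by_cases h : ∃ s ∈ Q, v = ℓ s
    · exact Or.inr h
    · exact Or.inl fun s hs hv ↦ h ⟨s, hs, hv.symm⟩
  have hglt (v : V) : g v < n := by
    rcases hcases v with hv | ⟨s, hs, rfl⟩
    · have := hlt v hv
      rw [hgpos v hv]
      omega
    · have := hlab s hs
      rw [hglab s hs]
      omega
  have hginj (u v : V) (h : g u = g v) : u = v := by
    rcases hcases u with hu | ⟨s, hs, rfl⟩ <;> rcases hcases v with hv | ⟨s', hs', rfl⟩
    · rw [hgpos u hu, hgpos v hv] at h
      exact hinj u v hu hv h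
    · rw [hgpos u hu, hglab s' hs'] at h
      have := hlt u hu
      have := hlab s' hs'
      omega
    · rw [hgpos v hv, hglab s hs] at h
      have := hlt v hv
      have := hlab s hs
      omega
    · rw [hglab s hs, hglab s' hs'] at h
      have := hlab s hs
      have := hlab s' hs'
      rw [hinj s s' (hℓQ s hs) (hℓQ s' hs') (by omega)]
  have hleaf (u s : V) (hs : s ∈ Q) : G.Adj u (ℓ s) ↔ u = s :=
    ⟨fun h ↦ (hℓ s hs).2 u h.symm, fun h ↦ h ▸ (hℓ s hs).1⟩
  let f (v : V) : Fin n := ⟨g v, hglt v⟩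
  have hf : Function.Bijective f := by
    rw [Fintype.bijective_iff_injective_and_card]
    exact ⟨fun u v h ↦ hginj u v (by simpa [f] using h), by simpa using hn⟩
  refine ⟨⟨Equiv.ofBijective f hf, ?_⟩⟩
  intro u v
  simp only [caterpillar, fromRel_adj, Equiv.ofBijective_apply, f, ne_eq, Fin.mk.injEq]
  rcases hcases u with hu | ⟨s, hs, rfl⟩ <;> rcases hcases v with hv | ⟨s', hs', rfl⟩
  · have := hlt u hu
    have := hlt v hv
    rw [hgpos u hu, hgpos v hv, hadj u v hu hv]
    omega
  · have hpu : u = s' ↔ pos u = pos s' :=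
      ⟨fun h ↦ h ▸ rfl, hinj u s' hu (hℓQ s' hs')⟩
    have := hlt u hu
    have := hlab s' hs'
    rw [hgpos u hu, hglab s' hs', hleaf u s' hs', hpu]
    omega
  · have hpv : v = s ↔ pos v = pos s :=
      ⟨fun h ↦ h ▸ rfl, hinj v s hv (hℓQ s hs)⟩
    have := hlt v hv
    have := hlab s hs
    rw [hgpos v hv, hglab s hs, adj_comm, hleaf v s hs, hpv]
    omega
  · have := hlab s hs
    have := hlab s' hs'
    have hne : ℓ s ≠ s' := hℓQ s' hs' s hs
    rw [hglab s hs, hglab s' hs', hleaf _ s' hs']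
    simp only [hne, iff_false]
    omega

lemma Connected.sub_le_dist (hG : G.Connected) {F : V → ℤ}
    (hF : ∀ x y, G.Adj x y → F y ≤ F x + 1) (u v : V) : F v - F u ≤ G.dist u v := by
  obtain ⟨p, hp⟩ := hG.exists_walk_length_eq_dist u v
  rw [← hp]
  clear hp
  induction p with
  | nil => simp
  | cons h _ ih =>
    have := hF _ _ h
    rw [Walk.length_cons]
    push_cast
    linarith

lemma two_mul_sum_range_linear (a b : ℤ) (m : ℕ) :
    2 * ∑ i ∈ Finset.range m, (a + b * i) = 2 * m * a + b * (m * (m - 1)) := by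
  induction m with
  | zero => simp
  | succ m ih =>
    rw [Finset.sum_range_succ, mul_add, ih]
    push_cast
    ring

/-- A lower bound for the status of a vertex lying at or hanging from the `x`-th vertex of the
spine of a caterpillar. -/
lemma le_sum_caterpillar {N p q x : ℕ} (hx : x < N) (hq : q ≤ N) :
    ((x + p : ℤ) ^ 2 + (N - 1 - x + q) ^ 2 + (N + p + q - 1)) - 2 * p ^ 2 - 2 * q ^ 2 ≤
      2 * (∑ i ∈ Finset.range N, |(i : ℤ) - x| + ∑ i ∈ Finset.range p, |(i : ℤ) - x| +
        ∑ i ∈ Finset.range q, |((N - q : ℤ) + i) - x|) := by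
  obtain ⟨y, rfl⟩ : ∃ y, N = x + (y + 1) := ⟨N - x - 1, by omega⟩
  have h₁ : ∑ i ∈ Finset.range x, ((x : ℤ) + -1 * i) ≤ ∑ i ∈ Finset.range x, |(i : ℤ) - x| :=
    Finset.sum_le_sum fun i _ ↦ by rw [abs_sub_comm]; exact le_trans (by linarith) (le_abs_self _)
  have h₂ : ∑ i ∈ Finset.range (y + 1), ((0 : ℤ) + 1 * i) ≤
      ∑ i ∈ Finset.range (y + 1), |((x + i : ℕ) : ℤ) - x| :=
    Finset.sum_le_sum fun i _ ↦ le_trans (by push_cast; linarith) (le_abs_self _)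
  have h₃ : ∑ i ∈ Finset.range p, ((x : ℤ) + -1 * i) ≤ ∑ i ∈ Finset.range p, |(i : ℤ) - x| :=
    Finset.sum_le_sum fun i _ ↦ by rw [abs_sub_comm]; exact le_trans (by linarith) (le_abs_self _)
  have h₄ : ∑ i ∈ Finset.range q, ((y + 1 - q : ℤ) + 1 * i) ≤
      ∑ i ∈ Finset.range q, |(((x + (y + 1) : ℕ) - q : ℤ) + i) - x| :=
    Finset.sum_le_sum fun i _ ↦ le_trans (by push_cast; linarith) (le_abs_self _)
  have e₁ := two_mul_sum_range_linear (x : ℤ) (-1) x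
  have e₂ := two_mul_sum_range_linear 0 1 (y + 1)
  have e₃ := two_mul_sum_range_linear (x : ℤ) (-1) p
  have e₄ := two_mul_sum_range_linear (y + 1 - q : ℤ) 1 q
  rw [Finset.sum_range_add]
  push_cast at *
  linarith

lemma exists_le_two_mul_status_of_iso_caterpillar [Fintype V] (hG : G.Connected) {N p q : ℕ}
    (hpq : p + q ≤ N) (hN : 2 ≤ N) (f : G ≃g caterpillar (N + p + q) p q) (c : V) :
    ∃ x : ℕ, ((x + p : ℤ) ^ 2 + (N - 1 - x + q) ^ 2 + (N + p + q - 1)) - 2 * p ^ 2 - 2 * q ^ 2 +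
      2 * (p + q) ≤ 2 * status G c := by
  classical
  let pos (a : ℕ) : ℕ := if a < N then a else if a < N + p then a - N else a - p - q
  let leaf (a : ℕ) : ℤ := if a < N then 0 else 1
  let F (v : V) : ℤ := |(pos (f v) : ℤ) - pos (f c)| + leaf (f v) +
    if v = c then -leaf (f c) else leaf (f c)
  have hc := (f c).isLt
  have hleaf (a : ℕ) : 0 ≤ leaf a := by
    simp only [leaf]
    split_ifs <;> norm_num
  have hx : pos (f c) < N := by
    simp only [pos]
    split_ifs <;> omega
  have hF (x y : V) (h : G.Adj x y) : F y ≤ F x + 1 := by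
    rw [← f.map_adj_iff] at h
    have hval (v : V) : v = c ↔ (f v : ℕ) = f c := by
      rw [← Fin.ext_iff, f.injective.eq_iff]
    simp only [caterpillar, fromRel_adj, ne_eq, Fin.ext_iff] at h
    have hx := (f x).isLt
    have hy := (f y).isLt
    simp only [F, hval, pos, leaf, Int.abs_eq_natAbs]
    generalize (f x : ℕ) = a at *
    generalize (f y : ℕ) = b at *
    generalize (f c : ℕ) = z at *
    split_ifs <;> omega
  have hdist : ∑ v, F v ≤ status G c := by
    unfold status
    push_cast
    refine Finset.sum_le_sum fun v _ ↦ ?_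
    have := hG.sub_le_dist hF c v
    have hFc : F c = 0 := by simp [F]
    linarith
  have hcard : Fintype.card V = N + p + q := by simpa using Fintype.card_congr f.toEquiv
  have hsum : ∑ v, (|(pos (f v) : ℤ) - pos (f c)| + leaf (f v)) ≤ ∑ v, F v := by
    have hcorr : 0 ≤ ∑ v, if v = c then -leaf (f c) else leaf (f c) := by
      rw [← Finset.add_sum_erase _ _ (Finset.mem_univ c), if_pos rfl,
        Finset.sum_congr rfl fun v hv ↦ if_neg (Finset.ne_of_mem_erase hv), Finset.sum_const,
        Finset.card_erase_of_mem (Finset.mem_univ c), Finset.card_univ, hcard, nsmul_eq_mul]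
      have h₁ : (1 : ℤ) ≤ ((N + p + q - 1 : ℕ) : ℤ) := by omega
      nlinarith [hleaf (f c)]
    simp only [F]
    rw [Finset.sum_add_distrib (g := fun v ↦ if v = c then -leaf (f c) else leaf (f c))]
    linarith
  have hre : ∑ v, (|(pos (f v) : ℤ) - pos (f c)| + leaf (f v)) =
      ∑ a ∈ Finset.range (N + p + q), (|(pos a : ℤ) - pos (f c)| + leaf a) := by
    rw [← Fin.sum_univ_eq_sum_range (fun a ↦ |(pos a : ℤ) - pos (f c)| + leaf a)]
    exact Equiv.sum_comp f.toEquiv fun a : Fin (N + p + q) ↦ |(pos a : ℤ) - pos (f c)| + leaf a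
  have h₁ : ∑ a ∈ Finset.range N, (|(pos a : ℤ) - pos (f c)| + leaf a) =
      ∑ a ∈ Finset.range N, |(a : ℤ) - pos (f c)| := by
    refine Finset.sum_congr rfl fun a ha ↦ ?_
    have ha := Finset.mem_range.mp ha
    simp only [leaf, if_pos ha, add_zero]
    rw [show pos a = a by simp only [pos, if_pos ha]]
  have h₂ : ∑ a ∈ Finset.range p, (|(pos (N + a) : ℤ) - pos (f c)| + leaf (N + a)) =
      ∑ a ∈ Finset.range p, (|(a : ℤ) - pos (f c)| + 1) := by
    refine Finset.sum_congr rfl fun a ha ↦ ?_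
    have ha := Finset.mem_range.mp ha
    rw [show leaf (N + a) = 1 by simp [leaf], show pos (N + a) = a by simp [pos, ha]]
  have h₃ : ∑ a ∈ Finset.range q, (|(pos (N + p + a) : ℤ) - pos (f c)| + leaf (N + p + a)) =
      ∑ a ∈ Finset.range q, (|((N - q : ℤ) + a) - pos (f c)| + 1) := by
    refine Finset.sum_congr rfl fun a ha ↦ ?_
    have ha := Finset.mem_range.mp ha
    have hpa : (pos (N + p + a) : ℤ) = (N - q : ℤ) + a := by
      simp only [pos]
      split_ifs <;> omega
    rw [show leaf (N + p + a) = 1 by simp [leaf, add_assoc], hpa]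
  have := le_sum_caterpillar (p := p) hx (show q ≤ N by omega)
  refine ⟨pos (f c), ?_⟩
  rw [hre, Finset.sum_range_add, Finset.sum_range_add, h₁, h₂, h₃, Finset.sum_add_distrib,
    Finset.sum_add_distrib] at hsum
  simp only [Finset.sum_const, Finset.card_range, nsmul_eq_mul, mul_one] at hsum
  linarith

/-- A lower bound for the status of a vertex of a balanced caterpillar. -/
lemma lt_four_mul_status_of_iso_caterpillar [Fintype V] (hG : G.Connected) {n k : ℕ}
    (hk : 2 * k ≤ n) (hn : 3 ≤ n) (f : G ≃g caterpillar n ((k + 1) / 2) (k / 2)) (c : V) :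
    (n : ℤ) ^ 2 - 2 * k ^ 2 < 4 * (status G c - k) + 4 := by
  obtain ⟨p, q, hp, hq, hpq⟩ : ∃ p q, (k + 1) / 2 = p ∧ k / 2 = q ∧ (q = p ∨ q + 1 = p) :=
    ⟨_, _, rfl, rfl, by omega⟩
  rw [hp, hq] at f
  obtain ⟨N, rfl⟩ : ∃ N, n = N + p + q := ⟨n - p - q, by omega⟩
  obtain ⟨x, hx⟩ := exists_le_two_mul_status_of_iso_caterpillar hG (by omega) (by omega) f c
  obtain rfl : k = p + q := by omega
  push_cast
  have h₁ := sq_nonneg ((x + p : ℤ) - (N - 1 - x + q))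
  have h₂ : ((p : ℤ) - q) ^ 2 ≤ 1 := by
    rcases hpq with rfl | rfl <;> simp
  nlinarith

end SimpleGraph

namespace SimpleGraph

variable {G : SimpleGraph V}

/-- The branches of a tree at a vertex of minimum status contain at most half of the vertices. -/
lemma IsTree.two_mul_card_branch_le [Fintype V] (hG : G.IsTree) {c u : V}
    (hc : status G c ≤ status G u) (hu : G.Adj c u) :
    2 * (Finset.univ.filter fun v ↦ G.dist u v < G.dist c v).card ≤ Fintype.card V := by
  have h : status G u + 2 * (Finset.univ.filter fun v ↦ G.dist u v < G.dist c v).card =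
      status G c + Fintype.card V := by
    unfold status
    rw [Finset.card_filter, Finset.mul_sum, ← Finset.sum_add_distrib, ← Finset.card_univ,
      Finset.card_eq_sum_ones, ← Finset.sum_add_distrib]
    refine Finset.sum_congr rfl fun v _ ↦ ?_
    have := hG.dist_add_one_eq_or v hu
    rw [dist_comm (v := c), dist_comm (v := u)] at this
    split_ifs <;> omega
  omega

/-- Every vertex other than `c` lies in the branch of exactly one neighbour of `c`. -/
lemma IsTree.exists_branch (hG : G.IsTree) (c : V) :
    ∃ b : V → V, (∀ v, v ≠ c → G.Adj c (b v) ∧ G.dist (b v) v + 1 = G.dist c v) ∧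
      ∀ v x, v ≠ c → x ≠ c → G.Adj v x → b v = b x := by
  have hex (v : V) : ∃ u, v ≠ c → G.Adj c u ∧ G.dist u v + 1 = G.dist c v := by
    by_cases hv : v = c
    · exact ⟨c, fun h ↦ absurd hv h⟩
    · obtain ⟨u, hu, hd⟩ := hG.connected.exists_adj_dist_add_one_eq (Ne.symm hv)
      exact ⟨u, fun _ ↦ ⟨hu, by rwa [dist_comm, dist_comm (u := c)]⟩⟩
  choose b hb using hex
  have key (v x : V) (hv : v ≠ c) (hx : x ≠ c) (h : G.Adj v x)
      (hd : G.dist c x + 1 = G.dist c v) : b v = b x := by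
    obtain ⟨hv₁, hv₂⟩ := hb v hv
    obtain ⟨hx₁, hx₂⟩ := hb x hx
    have h₁ := hG.dist_add_one_eq_or (b x) h
    have h₂ := hG.dist_add_one_eq_or v hx₁
    rw [dist_comm (v := c), dist_comm (v := b x)] at h₂
    refine hG.eq_of_adj_of_dist_add_one_eq (c := v) hv₁ hx₁ ?_ ?_ <;>
      rw [dist_comm, dist_comm (v := c)] <;> omega
  refine ⟨b, hb, fun v x hv hx h ↦ ?_⟩
  rcases hG.dist_add_one_eq_or c h with hd | hd
  · exact (key x v hx hv h.symm hd).symm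
  · exact key v x hv hx h hd

lemma IsTree.not_isLeafAt_of_status_le [Fintype V] (hG : G.IsTree) (hV : 3 ≤ Fintype.card V)
    {c : V} (hc : ∀ u, status G c ≤ status G u) (s : V) : ¬ G.IsLeafAt s c := by
  classical
  intro h
  have h₁ := hG.two_mul_card_branch_le (hc s) h.1.symm
  obtain ⟨b, hb, -⟩ := hG.exists_branch c
  have h₂ : (Finset.univ.erase c).card ≤
      (Finset.univ.filter fun v ↦ G.dist s v < G.dist c v).card := by
    refine Finset.card_le_card fun v hv ↦ ?_
    obtain ⟨hv₁, hv₂⟩ := hb v (Finset.ne_of_mem_erase hv)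
    rw [h.2 _ hv₁] at hv₂
    simp only [Finset.mem_filter, Finset.mem_univ, true_and]
    omega
  rw [Finset.card_erase_of_mem (Finset.mem_univ c), Finset.card_univ] at h₂
  omega

lemma IsTree.dist_eq_of_isLeafAt (hG : G.IsTree) {c s l : V} (hc : ∀ s, ¬ G.IsLeafAt s c)
    (h : G.IsLeafAt s l) : G.dist c l = G.dist c s + 1 := by
  have hlc : l ≠ c := by
    rintro rfl
    exact hc s h
  obtain ⟨u, hu, hd⟩ := hG.connected.exists_adj_dist_add_one_eq hlc
  rw [← h.2 u hu, hd]

lemma IsTree.nonempty_iso_caterpillar_of_layers [Fintype V] (hG : G.IsTree) {n p q : ℕ}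
    (hn : Fintype.card V = n) (hpq : 2 * (p + q) ≤ n) {Q : Finset V} {ℓ : V → V}
    (hℓ : ∀ s ∈ Q, G.IsLeafAt s (ℓ s)) (hℓQ : ∀ s ∈ Q, ∀ s' ∈ Q, ℓ s' ≠ s) {c : V}
    (hpar : ∀ v, (∀ s ∈ Q, ℓ s ≠ v) → v ≠ c →
      ∃ x, (∀ s ∈ Q, ℓ s ≠ x) ∧ G.Adj v x ∧ G.dist c x + 1 = G.dist c v)
    {P₁ P₂ : Finset V} (hcov : ∀ v, (∀ s ∈ Q, ℓ s ≠ v) → v ≠ c → v ∈ P₁ ∨ v ∈ P₂)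
    (hcl₁ : ∀ v ∈ P₁, ∀ x, (∀ s ∈ Q, ℓ s ≠ x) → x ≠ c → G.Adj v x → x ∈ P₁)
    (hcl₂ : ∀ v ∈ P₂, ∀ x, (∀ s ∈ Q, ℓ s ≠ x) → x ≠ c → G.Adj v x → x ∈ P₂)
    (hP : Disjoint P₁ P₂) (hlay₁ : IsLayered (G.dist c) P₁) (hlay₂ : IsLayered (G.dist c) P₂)
    (hinj₁ : Set.InjOn (G.dist c) P₁) (hinj₂ : Set.InjOn (G.dist c) P₂)
    (hcard : P₁.card + P₂.card + 1 = n - p - q) (hp : p ≤ P₁.card + 1) (hq : q ≤ P₂.card + 1)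
    (hQ₁ : ∀ v ∈ P₁, (v ∈ Q ↔ P₁.card < G.dist c v + p))
    (hQ₂ : ∀ v ∈ P₂, (v ∈ Q ↔ P₂.card < G.dist c v + q))
    (hQc : c ∈ Q ↔ P₁.card < p ∨ P₂.card < q) :
    Nonempty (G ≃g caterpillar n p q) := by
  classical
  let pos (v : V) : ℕ :=
    if v = c then P₁.card else if v ∈ P₁ then P₁.card - G.dist c v else P₁.card + G.dist c v
  have hd (v : V) (hv : G.dist c v = 0) : v = c :=
    (hG.connected.dist_eq_zero_iff.mp hv).symm
  have hdc : G.dist c c = 0 := dist_self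
  have hposc : pos c = P₁.card := if_pos rfl
  have hpos₁ (v : V) (hv : v ∈ P₁) :
      pos v + G.dist c v = P₁.card ∧ 1 ≤ G.dist c v := by
    have h₁ := (hlay₁ v hv).1
    have h₂ := hlay₁.le_card hv
    have hvc : v ≠ c := by
      rintro rfl
      omega
    simp only [pos, if_neg hvc, if_pos hv]
    omega
  have hpos₂ (v : V) (hv : v ∈ P₂) :
      pos v = P₁.card + G.dist c v ∧ 1 ≤ G.dist c v ∧ G.dist c v ≤ P₂.card := by
    have h₁ := (hlay₂ v hv).1
    have h₂ := hlay₂.le_card hv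
    have hvc : v ≠ c := by
      rintro rfl
      omega
    refine ⟨?_, h₁, h₂⟩
    simp only [pos, if_neg hvc, if_neg (Finset.disjoint_right.mp hP hv)]
  have hcases (v : V) (hv : ∀ s ∈ Q, ℓ s ≠ v) : v = c ∨ v ∈ P₁ ∨ v ∈ P₂ := by
    by_cases hvc : v = c
    · exact Or.inl hvc
    · exact Or.inr (hcov v hv hvc)
  have hnext (u v : V) (hu : ∀ s ∈ Q, ℓ s ≠ u) (hv : ∀ s ∈ Q, ℓ s ≠ v)
      (h : pos u + 1 = pos v) : G.Adj u v := by
    rcases hcases u hu with rfl | hu' | hu' <;> rcases hcases v hv with rfl | hv' | hv'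
    · omega
    · have := hpos₁ v hv'
      omega
    · have := hpos₂ v hv'
      obtain ⟨x, hx, hadj, hxd⟩ := hpar v hv (by rintro rfl; omega)
      rw [← hd x (by omega)]
      exact hadj.symm
    · have := hpos₁ u hu'
      obtain ⟨x, hx, hadj, hxd⟩ := hpar u hu (by rintro rfl; omega)
      rw [← hd x (by omega)]
      exact hadj
    · have h₁ := hpos₁ u hu'
      have h₂ := hpos₁ v hv'
      obtain ⟨x, hx, hadj, hxd⟩ := hpar u hu (by rintro rfl; omega)
      have hx' := hcl₁ u hu' x hx (by rintro rfl; omega) hadj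
      rw [← hinj₁ hx' hv' (by omega)]
      exact hadj
    · have := hpos₁ u hu'
      have := hpos₂ v hv'
      omega
    · have := hpos₂ u hu'
      omega
    · have := hpos₂ u hu'
      have := hpos₁ v hv'
      omega
    · have h₁ := hpos₂ u hu'
      have h₂ := hpos₂ v hv'
      obtain ⟨x, hx, hadj, hxd⟩ := hpar v hv (by rintro rfl; omega)
      have hx' := hcl₂ v hv' x hx (by rintro rfl; omega) hadj
      rw [← hinj₂ hx' hu' (by omega)]
      exact hadj.symm
  refine nonempty_iso_caterpillar hn hpq hℓ hℓQ (pos := pos) ?_ ?_ ?_ ?_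
  · intro v hv
    rcases hcases v hv with rfl | hv' | hv'
    · omega
    · have := hpos₁ v hv'
      omega
    · have := hpos₂ v hv'
      omega
  · intro u v hu hv h
    rcases hcases u hu with rfl | hu' | hu' <;> rcases hcases v hv with rfl | hv' | hv'
    · rfl
    · have := hpos₁ v hv'
      omega
    · have := hpos₂ v hv'
      omega
    · have := hpos₁ u hu'
      omega
    · have := hpos₁ u hu'
      have := hpos₁ v hv'
      exact hinj₁ hu' hv' (by omega)
    · have := hpos₁ u hu'
      have := hpos₂ v hv'
      omega
    · have := hpos₂ u hu'
      omega
    · have := hpos₂ u hu'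
      have := hpos₁ v hv'
      omega
    · have := hpos₂ u hu'
      have := hpos₂ v hv'
      exact hinj₂ hu' hv' (by omega)
  · intro u v hu hv
    refine ⟨fun h ↦ ?_, ?_⟩
    · have hdist := hG.dist_add_one_eq_or c h
      by_cases huc : u = c
      · subst huc
        rcases hcases v hv with rfl | hv' | hv'
        · omega
        · have := hpos₁ v hv'
          omega
        · have := hpos₂ v hv'
          omega
      by_cases hvc : v = c
      · subst hvc
        rcases hcases u hu with rfl | hu' | hu'
        · omega
        · have := hpos₁ u hu'
          omega
        · have := hpos₂ u hu'
          omega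
      rcases hcov u hu huc with hu' | hu'
      · have := hpos₁ u hu'
        have := hpos₁ v (hcl₁ u hu' v hv hvc h)
        omega
      · have := hpos₂ u hu'
        have := hpos₂ v (hcl₂ u hu' v hv hvc h)
        omega
    · rintro (h | h)
      · exact hnext u v hu hv h
      · exact (hnext v u hv hu h).symm
  · intro v hv
    rcases hcases v hv with rfl | hv' | hv'
    · rw [hQc]
      omega
    · have := hpos₁ v hv'
      have := hlay₁.le_card hv'
      rw [hQ₁ v hv']
      omega
    · have := hpos₂ v hv'
      rw [hQ₂ v hv']
      omega

end SimpleGraph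

lemma Finset.sum_eq_sum_filter_add {α β : Type*} [DecidableEq β] {M : Type*} [AddCommMonoid M]
    (U : Finset α) (b : α → β) {u₁ u₂ : β} (hu : u₁ ≠ u₂) (f : α → M) :
    ∑ v ∈ U, f v = ∑ v ∈ U with b v = u₁, f v + ∑ v ∈ U with b v = u₂, f v +
      ∑ v ∈ U with b v ≠ u₁ ∧ b v ≠ u₂, f v := by
  simp only [Finset.sum_filter]
  rw [← Finset.sum_add_distrib, ← Finset.sum_add_distrib]
  refine Finset.sum_congr rfl fun v _ ↦ ?_
  by_cases h₁ : b v = u₁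
  · simp [h₁, hu]
  · by_cases h₂ : b v = u₂ <;> simp [h₁, h₂, hu.symm]

/-- Among the fibres of `b` there are two such that every other fibre has height at most
the cardinality of both of them. -/
lemma IsLayered.exists_fibers {α : Type*} [Fintype α] [DecidableEq α] [Nontrivial α] {d : α → ℕ}
    {U : Finset α} {b : α → α} (h : ∀ u, IsLayered d (U.filter fun v ↦ b v = u)) :
    ∃ u₁ u₂, u₁ ≠ u₂ ∧ ∀ v ∈ U.filter fun v ↦ b v ≠ u₁ ∧ b v ≠ u₂,
      d v ≤ (U.filter fun v ↦ b v = u₁).card ∧ d v ≤ (U.filter fun v ↦ b v = u₂).card := by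
  let height (u : α) : ℕ := (U.filter fun v ↦ b v = u).sup d
  have hle (u : α) : height u ≤ (U.filter fun v ↦ b v = u).card :=
    Finset.sup_le fun v hv ↦ (h u).le_card hv
  obtain ⟨u₁, -, hu₁⟩ := Finset.exists_max_image Finset.univ height Finset.univ_nonempty
  obtain ⟨u, hu⟩ := exists_ne u₁
  obtain ⟨u₂, hu₂, hmax⟩ := Finset.exists_max_image (Finset.univ.erase u₁) height
    ⟨u, by simpa using hu⟩
  refine ⟨u₁, u₂, (Finset.ne_of_mem_erase hu₂).symm, fun v hv ↦ ?_⟩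
  obtain ⟨hv, hv₁, hv₂⟩ := Finset.mem_filter.mp hv
  have hd : d v ≤ height (b v) := Finset.le_sup (Finset.mem_filter.mpr ⟨hv, rfl⟩)
  exact ⟨hd.trans ((hu₁ _ (Finset.mem_univ _)).trans (hle u₁)),
    hd.trans ((hmax _ (by simpa using hv₁)).trans (hle u₂))⟩

namespace SimpleGraph

variable {G : SimpleGraph V}

/-- The minimum status of a tree in terms of the number of its support vertices. -/
lemma IsTree.four_mul_status_le_and [Fintype V] (hG : G.IsTree) {n : ℕ}
    (hn : Fintype.card V = n) (hn3 : 3 ≤ n) {c : V} (hc : ∀ u, status G c ≤ status G u)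
    {Q : Finset V} (hQ : ∀ s, s ∈ Q ↔ ∃ l, G.IsLeafAt s l) :
    2 * Q.card ≤ n ∧ 4 * ((status G c : ℤ) - Q.card) ≤ (n : ℤ) ^ 2 - 2 * Q.card ^ 2 ∧
      ((n : ℤ) ^ 2 - 2 * Q.card ^ 2 < 4 * ((status G c : ℤ) - Q.card) + 4 →
        Nonempty (G ≃g caterpillar n ((Q.card + 1) / 2) (Q.card / 2))) := by
  classical
  have : Nontrivial V := Fintype.one_lt_card_iff_nontrivial.mp (by omega)
  have hex (s : V) : ∃ l, s ∈ Q → G.IsLeafAt s l := by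
    by_cases hs : s ∈ Q
    · obtain ⟨l, hl⟩ := (hQ s).mp hs
      exact ⟨l, fun _ ↦ hl⟩
    · exact ⟨s, fun h ↦ absurd h hs⟩
  choose ℓ hℓ using hex
  have hcl := hG.not_isLeafAt_of_status_le (by omega) hc
  have hdℓ (s : V) (hs : s ∈ Q) : G.dist c (ℓ s) = G.dist c s + 1 :=
    hG.dist_eq_of_isLeafAt hcl (hℓ s hs)
  have hℓc (s : V) (hs : s ∈ Q) : ℓ s ≠ c := by
    intro h
    exact hcl s (h ▸ hℓ s hs)
  have hℓinj : Set.InjOn ℓ Q := by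
    intro s hs s' hs' h
    exact (hℓ s' hs').2 s (h ▸ (hℓ s hs).1.symm)
  have hℓQ (s : V) (hs : s ∈ Q) (s' : V) (hs' : s' ∈ Q) : ℓ s' ≠ s := by
    rintro rfl
    have h₁ := hdℓ _ hs
    have h₂ := hdℓ _ hs'
    rw [(hℓ s' hs').2 _ (hℓ _ hs).1] at h₁
    omega
  obtain ⟨b, hb, hbadj⟩ := hG.exists_branch c
  let U : Finset V := Finset.univ.filter fun v ↦ (∀ s ∈ Q, ℓ s ≠ v) ∧ v ≠ c
  have hU (v : V) : v ∈ U ↔ (∀ s ∈ Q, ℓ s ≠ v) ∧ v ≠ c := by simp [U]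
  let w (v : V) : ℕ := if v ∈ Q then 2 else 1
  have hw (v : V) : w v = 1 ∨ w v = 2 := by
    by_cases hv : v ∈ Q <;> simp [w, hv]
  have hwQ (v : V) : w v = 2 ↔ v ∈ Q := by
    by_cases hv : v ∈ Q <;> simp [w, hv]
  -- Every vertex is `c`, an element of `U` or a chosen leaf, and `w` counts the chosen leaves.
  have hsplit (f : V → ℕ) : ∑ v, f v = ∑ v ∈ U, f v + f c + ∑ s ∈ Q, f (ℓ s) := by
    rw [← Finset.sum_image (f := f) (g := ℓ) hℓinj, add_assoc, ← Finset.sum_insert,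
      ← Finset.sum_union]
    · congr 1
      ext v
      simp only [Finset.mem_univ, Finset.mem_union, hU, Finset.mem_insert, Finset.mem_image,
        true_iff]
      by_cases hv : ∃ s ∈ Q, ℓ s = v
      · exact Or.inr (Or.inr hv)
      · push Not at hv
        tauto
    · rw [Finset.disjoint_left]
      intro v hv hv'
      rw [hU] at hv
      simp only [Finset.mem_insert, Finset.mem_image] at hv'
      rcases hv' with rfl | ⟨s, hs, rfl⟩
      · exact hv.2 rfl
      · exact hv.1 s hs rfl
    · simp only [Finset.mem_image, not_exists, not_and]
      exact hℓc
  have hQsum (f : V → ℕ) : ∑ s ∈ Q, f s = ∑ v ∈ U, (if v ∈ Q then f v else 0) +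
      if c ∈ Q then f c else 0 := by
    have h := hsplit fun v ↦ if v ∈ Q then f v else 0
    rw [Finset.sum_ite_mem, Finset.univ_inter] at h
    rw [h, add_eq_left]
    exact Finset.sum_eq_zero fun s hs ↦ if_neg fun h ↦ hℓQ _ h s hs rfl
  have hwsum (f : V → ℕ) (P : Finset V) :
      ∑ v ∈ P, w v * f v = ∑ v ∈ P, f v + ∑ v ∈ P, (if v ∈ Q then f v else 0) := by
    rw [← Finset.sum_add_distrib]
    refine Finset.sum_congr rfl fun v _ ↦ ?_
    simp only [w]
    split_ifs <;> ring
  have hcardU : U.card + 1 + Q.card = n := by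
    simpa [hn] using (hsplit fun _ ↦ 1).symm
  have hWU : ∑ v ∈ U, w v + w c = n := by
    have h₁ := hQsum fun _ ↦ 1
    have h₂ := hwsum (fun _ ↦ 1) U
    rw [← Finset.card_eq_sum_ones] at h₁ h₂
    simp only [mul_one] at h₂
    simp only [w] at h₂ ⊢
    split_ifs at h₁ ⊢ <;> omega
  have hstat : status G c = ∑ v ∈ U, w v * G.dist c v + Q.card := by
    have h₁ := hQsum (G.dist c)
    rw [dist_self, ite_self, add_zero] at h₁
    rw [hwsum, ← h₁, status, hsplit, dist_self, add_zero, Finset.sum_congr rfl hdℓ,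
      Finset.sum_add_distrib, ← Finset.card_eq_sum_ones, add_assoc]
  have hpar (v : V) (hv : ∀ s ∈ Q, ℓ s ≠ v) (hvc : v ≠ c) :
      ∃ x, (∀ s ∈ Q, ℓ s ≠ x) ∧ G.Adj v x ∧ G.dist c x + 1 = G.dist c v := by
    obtain ⟨x, hx, hd⟩ := hG.connected.exists_adj_dist_add_one_eq hvc
    refine ⟨x, fun s hs h ↦ ?_, hx, hd⟩
    subst h
    have h₁ := hdℓ s hs
    rw [(hℓ s hs).2 v hx.symm] at hd
    omega
  have hlay (u : V) : IsLayered (G.dist c) (U.filter fun v ↦ b v = u) := by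
    intro v hv
    rw [Finset.mem_filter, hU] at hv
    obtain ⟨⟨hv, hvc⟩, rfl⟩ := hv
    refine ⟨hG.connected.pos_dist_of_ne hvc.symm, fun h2 ↦ ?_⟩
    obtain ⟨x, hx, hadj, hd⟩ := hpar v hv hvc
    have hxc : x ≠ c := by
      rintro rfl
      rw [dist_self] at hd
      omega
    exact ⟨x, Finset.mem_filter.mpr ⟨(hU x).mpr ⟨hx, hxc⟩, (hbadj v x hvc hxc hadj).symm⟩, hd⟩
  have hhalf (u : V) : 2 * ∑ v ∈ U with b v = u, w v ≤ n := by
    rcases (U.filter fun v ↦ b v = u).eq_empty_or_nonempty with h | ⟨x, hx⟩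
    · simp [h]
    rw [Finset.mem_filter, hU] at hx
    have hu : G.Adj c u := hx.2 ▸ (hb x hx.1.2).1
    refine le_trans (Nat.mul_le_mul_left 2 ?_)
      ((hG.two_mul_card_branch_le (hc u) hu).trans hn.le)
    set P := U.filter fun v ↦ b v = u with hP
    have hlt (v : V) (hv : v ∈ P) : G.dist u v + 1 = G.dist c v := by
      rw [hP, Finset.mem_filter, hU] at hv
      exact hv.2 ▸ (hb v hv.1.2).2
    have h := hwsum (fun _ ↦ 1) P
    simp only [mul_one] at h
    rw [h, ← Finset.card_eq_sum_ones, ← Finset.card_filter,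
      ← Finset.card_image_of_injOn (f := ℓ) (s := P.filter fun v ↦ v ∈ Q)
        (hℓinj.mono fun v hv ↦ (Finset.mem_filter.mp hv).2), ← Finset.card_union_of_disjoint]
    · refine Finset.card_le_card fun v hv ↦ Finset.mem_filter.mpr ⟨Finset.mem_univ v, ?_⟩
      rcases Finset.mem_union.mp hv with hv | hv
      · have := hlt v hv
        omega
      · obtain ⟨s, hs, rfl⟩ := Finset.mem_image.mp hv
        obtain ⟨hs, hsQ⟩ := Finset.mem_filter.mp hs
        have h₁ := hlt s hs
        have h₂ := hdℓ s hsQ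
        have h₃ : G.dist u (ℓ s) ≤ G.dist u s + G.dist s (ℓ s) := hG.connected.dist_triangle
        rw [dist_eq_one_iff_adj.mpr (hℓ s hsQ).1] at h₃
        omega
    · rw [Finset.disjoint_left]
      intro v hv hv'
      rw [hP, Finset.mem_filter, hU] at hv
      obtain ⟨s, hs, rfl⟩ := Finset.mem_image.mp hv'
      exact hv.1.1 s (Finset.mem_filter.mp hs).2 rfl
  have hσ : 2 * Q.card ≤ n := by
    rw [two_mul, ← hn, ← Finset.card_univ]
    nth_rw 2 [← Finset.card_image_of_injOn hℓinj]
    rw [← Finset.card_union_of_disjoint]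
    · exact Finset.card_le_univ _
    · rw [Finset.disjoint_left]
      intro v hv hv'
      obtain ⟨s, hs, rfl⟩ := Finset.mem_image.mp hv'
      exact hℓQ _ hv s hs rfl
  obtain ⟨u₁, u₂, hne, hO⟩ := IsLayered.exists_fibers hlay
  have hWsplit := U.sum_eq_sum_filter_add b hne w
  have hSsplit := U.sum_eq_sum_filter_add b hne fun v ↦ w v * G.dist c v
  have hCsplit := U.sum_eq_sum_filter_add b hne fun _ ↦ 1
  simp only [← Finset.card_eq_sum_ones] at hCsplit
  obtain ⟨hle, hlt⟩ := (hlay u₁).four_mul_sum_le_and (hlay u₂) hw (fun v hv ↦ (hO v hv).1)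
    (fun v hv ↦ (hO v hv).2) (hw c) (hhalf u₁) (hhalf u₂) (k := Q.card) (by omega) (by omega)
    (S := status G c - Q.card) (by omega)
  refine ⟨hσ, hle, fun h ↦ ?_⟩
  obtain ⟨hempty, hinj₁, hinj₂, hQ₁, hQ₂, κ₁, κ₂, hκ₁, hκ₂, hcase⟩ := hlt h
  simp only [hwQ, hκ₁, hκ₂] at hQ₁ hQ₂
  rw [hempty, Finset.card_empty] at hCsplit
  rw [hempty, Finset.sum_empty] at hWsplit
  have hu₁ := sum_weight_le_two_mul_card (P := U.filter fun v ↦ b v = u₁) fun v _ ↦ hw v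
  have hu₂ := sum_weight_le_two_mul_card (P := U.filter fun v ↦ b v = u₂) fun v _ ↦ hw v
  have hcov (v : V) (hv : ∀ s ∈ Q, ℓ s ≠ v) (hvc : v ≠ c) :
      v ∈ U.filter (fun v ↦ b v = u₁) ∨ v ∈ U.filter (fun v ↦ b v = u₂) := by
    have hvU := (hU v).mpr ⟨hv, hvc⟩
    by_contra! hv'
    simp only [Finset.mem_filter, hvU, true_and] at hv'
    exact Finset.notMem_empty v (hempty ▸ Finset.mem_filter.mpr ⟨hvU, hv'⟩)
  have hclosed (u v : V) (hv : v ∈ U.filter fun v ↦ b v = u) (x : V) (hx : ∀ s ∈ Q, ℓ s ≠ x)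
      (hxc : x ≠ c) (hadj : G.Adj v x) : x ∈ U.filter fun v ↦ b v = u := by
    rw [Finset.mem_filter, hU] at hv ⊢
    exact ⟨⟨hx, hxc⟩, (hbadj v x hv.1.2 hxc hadj) ▸ hv.2⟩
  have hdisj : Disjoint (U.filter fun v ↦ b v = u₁) (U.filter fun v ↦ b v = u₂) := by
    rw [Finset.disjoint_left]
    intro v hv hv'
    exact hne ((Finset.mem_filter.mp hv).2.symm.trans (Finset.mem_filter.mp hv').2)
  -- The central vertex counts towards one of the two ends if it is a support vertex.
  obtain ⟨p, q, hp₁, hp, hq₁, hq, hpq, hbal, hpc⟩ : ∃ p q, κ₁ ≤ p ∧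
      (p = κ₁ ∨ p = κ₁ + 1 ∧ κ₁ = (U.filter fun v ↦ b v = u₁).card) ∧ κ₂ ≤ q ∧
      (q = κ₂ ∨ q = κ₂ + 1 ∧ κ₂ = (U.filter fun v ↦ b v = u₂).card) ∧
      p + q = Q.card ∧ (p ≤ q + 1 ∧ q ≤ p + 1) ∧ (w c = 2 ↔ p + q = κ₁ + κ₂ + 1) := by
    rcases hcase with ⟨h₀, h₁, h₂⟩ | ⟨h₀, h₁, h₂, h₃⟩ | ⟨h₀, h₁, h₂, h₃⟩
    · exact ⟨κ₁, κ₂, by omega⟩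
    · exact ⟨κ₁ + 1, κ₂, by omega⟩
    · exact ⟨κ₁, κ₂ + 1, by omega⟩
  rw [hwQ] at hpc
  have hQ₁' (v : V) (hv : v ∈ U.filter fun v ↦ b v = u₁) :
      v ∈ Q ↔ (U.filter fun v ↦ b v = u₁).card < G.dist c v + p := by
    have := (hlay u₁ v hv).1
    rw [hQ₁ v hv]
    omega
  have hQ₂' (v : V) (hv : v ∈ U.filter fun v ↦ b v = u₂) :
      v ∈ Q ↔ (U.filter fun v ↦ b v = u₂).card < G.dist c v + q := by
    have := (hlay u₂ v hv).1
    rw [hQ₂ v hv]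
    omega
  rcases le_total q p with hqp | hqp
  · rw [show (Q.card + 1) / 2 = p by omega, show Q.card / 2 = q by omega]
    exact hG.nonempty_iso_caterpillar_of_layers hn (by omega) hℓ hℓQ hpar hcov (hclosed u₁)
      (hclosed u₂) hdisj (hlay u₁) (hlay u₂) hinj₁ hinj₂ (by omega) (by omega) (by omega)
      hQ₁' hQ₂' (by rw [hpc]; omega)
  · rw [show (Q.card + 1) / 2 = q by omega, show Q.card / 2 = p by omega]
    exact hG.nonempty_iso_caterpillar_of_layers hn (by omega) hℓ hℓQ hpar
      (fun v hv hvc ↦ (hcov v hv hvc).symm) (hclosed u₂) (hclosed u₁) hdisj.symm (hlay u₂)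
      (hlay u₁) hinj₂ hinj₁ (by omega) (by omega) (by omega) hQ₂' hQ₁' (by rw [hpc]; omega)

end SimpleGraph

/-- Upper bound on the minimum status of a tree with order `n` and domination
number `γ` with `⌈n/3⌉ < γ ≤ ⌊n/2⌋`, with equality iff
`T ≅ C_n(⌈(3γ-n)/2⌉, ⌊(3γ-n)/2⌋)`. -/
theorem stmt13 [Fintype V] (T : SimpleGraph V) (n γ : ℕ)
    (hn : Fintype.card V = n) (hT : T.IsTree)
    (hγ : domNumber T = γ) (h1 : (n + 2) / 3 < γ) (h2 : 2 * γ ≤ n) :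
    minStatus T ≤ 3 * n * γ + 3 * γ - n - (n ^ 2 + 18 * γ ^ 2 + 3) / 4 ∧
      (minStatus T = 3 * n * γ + 3 * γ - n - (n ^ 2 + 18 * γ ^ 2 + 3) / 4 ↔
        Nonempty (T ≃g caterpillar n ((3 * γ - n + 1) / 2) ((3 * γ - n) / 2))) := by
  classical
  obtain ⟨k, hk⟩ : ∃ k, 3 * γ = n + k := ⟨3 * γ - n, by omega⟩
  have hk3 : 3 ≤ k := by omega
  have : Nontrivial V := Fintype.one_lt_card_iff_nontrivial.mp (by omega)
  obtain ⟨c, hc⟩ : minStatus T ∈ Set.range (status T) := Nat.sInf_mem (Set.range_nonempty _)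
  have hmin (u : V) : status T c ≤ status T u := hc ▸ Nat.sInf_le ⟨u, rfl⟩
  have hdom := hT.three_mul_domNumber_le
  rw [hγ, hn, hk, add_le_add_iff_left] at hdom
  set Q := Finset.univ.filter fun s ↦ ∃ l, T.IsLeafAt s l with hQ
  obtain ⟨-, hle, hiso⟩ := hT.four_mul_status_le_and hn (by omega) hmin (Q := Q)
    fun s ↦ by simp [hQ]
  rw [hc] at hle hiso
  have hle' : 4 * ((minStatus T : ℤ) - k) ≤ (n : ℤ) ^ 2 - 2 * k ^ 2 := by
    zify at hdom hk3
    nlinarith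
  have hQk (h : (n : ℤ) ^ 2 - 2 * k ^ 2 < 4 * ((minStatus T : ℤ) - k) + 4) : Q.card = k := by
    by_contra hne
    have hlt : k + 1 ≤ Q.card := by omega
    zify at hlt hk3
    nlinarith
  have hsq : 2 * k ^ 2 ≤ n ^ 2 := by
    have : (2 * k) ^ 2 ≤ n ^ 2 := Nat.pow_le_pow_left (by omega) 2
    rw [mul_pow] at this
    omega
  have hbound : 3 * n * γ + 3 * γ - n - (n ^ 2 + 18 * γ ^ 2 + 3) / 4 =
      k + (n ^ 2 - 2 * k ^ 2) / 4 := by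
    have h₁ : 3 * n * γ = n ^ 2 + n * k := by
      rw [mul_right_comm, hk]
      ring
    have h₂ : 18 * γ ^ 2 = 2 * n ^ 2 + 4 * (n * k) + 2 * k ^ 2 := by
      rw [show 18 * γ ^ 2 = 2 * (3 * γ) ^ 2 by ring, hk]
      ring
    omega
  rw [hbound, show 3 * γ - n = k by omega]
  have hnear : minStatus T = k + (n ^ 2 - 2 * k ^ 2) / 4 ↔
      (n : ℤ) ^ 2 - 2 * k ^ 2 < 4 * ((minStatus T : ℤ) - k) + 4 := by
    zify
    rw [Nat.cast_sub hsq]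
    push_cast
    omega
  refine ⟨?_, hnear.trans ⟨fun h ↦ ?_, fun ⟨f⟩ ↦ ?_⟩⟩
  · zify
    rw [Nat.cast_sub hsq]
    push_cast
    omega
  · rw [hQk h] at hiso
    exact hiso h
  · rw [← hc]
    exact lt_four_mul_status_of_iso_caterpillar hT.connected (by omega) (by omega) f c
end
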